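/- arXiv:1101.5022 — 2 statements merged into one kernel-verified Lean document; each statement's English description precedes it below -/
import Mathlib

section
/- There exists a constant C' > 0, depending only on σ and s, such that for every integer k ≥ 1 with k odd or σ ≥ 0, one has ξ_k(x)² ≤ C' k^{−1/6} for all x ≠ 0. -/
open MeasureTheory Real Set

/-- The function `ξ_k = |x|^σ p_k(x) e^{−sx²/2}`. -/
noncomputable def xiF (σ s : ℝ) (p : ℕ → Polynomial ℝ) (k : ℕ) (x : ℝ) : ℝ :=
  |x| ^ σ * ((p k).eval x * Real.exp (-s * x ^ 2 / 2))

namespace GeneralizedHermite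

/-- The potential `N² (1 - t²) - c / t²` of the rescaled equation `V'' + q V = 0`. -/
noncomputable def potential (N c t : ℝ) : ℝ := N ^ 2 * (1 - t ^ 2) - c / t ^ 2

lemma hasDerivAt_potential (N c : ℝ) {t : ℝ} (ht : t ≠ 0) :
    HasDerivAt (potential N c) (-(2 * N ^ 2 * t) + 2 * c / t ^ 3) t := by
  unfold potential
  have h1 : HasDerivAt (fun t : ℝ => t ^ 2) (2 * t) t := by simpa using hasDerivAt_pow 2 t
  have h2 := ((h1.const_sub 1).const_mul (N ^ 2)).sub
    ((hasDerivAt_const t c).div h1 (pow_ne_zero 2 ht))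
  refine h2.congr_deriv ?_
  field_simp
  ring

/-- `V` and its derivative `W` solve `V'' + (N² (1 - t²) - c / t²) V = 0` on the half-line. -/
structure IsSolution (N c : ℝ) (V W : ℝ → ℝ) : Prop where
  left : ∀ t, 0 < t → HasDerivAt V (W t) t
  right : ∀ t, 0 < t → HasDerivAt W (-potential N c t * V t) t

namespace IsSolution

variable {N c : ℝ} {V W : ℝ → ℝ}

lemma hasDerivAt_energy (h : IsSolution N c V W) {t : ℝ} (ht : 0 < t) :
    HasDerivAt (fun t => W t ^ 2 + potential N c t * V t ^ 2)
      ((-(2 * N ^ 2 * t) + 2 * c / t ^ 3) * V t ^ 2) t := by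
  have h1 := ((h.right t ht).fun_pow 2).fun_add
    ((hasDerivAt_potential N c ht.ne').fun_mul ((h.left t ht).fun_pow 2))
  refine h1.congr_deriv ?_
  simp
  ring

lemma hasDerivAt_mul (h : IsSolution N c V W) {t : ℝ} (ht : 0 < t) :
    HasDerivAt (fun t => V t * W t) (W t ^ 2 - potential N c t * V t ^ 2) t := by
  refine ((h.left t ht).fun_mul (h.right t ht)).congr_deriv ?_
  ring

lemma hasDerivAt_sq (h : IsSolution N c V W) {t : ℝ} (ht : 0 < t) :
    HasDerivAt (fun t => V t ^ 2) (2 * (V t * W t)) t := by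
  refine ((h.left t ht).fun_pow 2).congr_deriv ?_
  simp
  ring

lemma sq_le_of_sq_le (h : IsSolution N c V W) {a b x y A : ℝ} (ha : 0 < a)
    (hA : 0 ≤ A) (hW : ∀ t ∈ Icc a b, W t ^ 2 ≤ A ^ 2) (hx : x ∈ Icc a b) (hy : y ∈ Icc a b) :
    V y ^ 2 ≤ 2 * V x ^ 2 + 2 * (A * |y - x|) ^ 2 := by
  have h1 := (convex_Icc a b).norm_image_sub_le_of_norm_hasDerivWithin_le (f := V) (f' := W)
    (C := A) (fun t ht => (h.left t (ha.trans_le ht.1)).hasDerivWithinAt)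
    (fun t ht => abs_le_of_sq_le_sq (hW t ht) hA) hx hy
  simp only [Real.norm_eq_abs] at h1
  have h2 : (V y - V x) ^ 2 ≤ (A * |y - x|) ^ 2 := by
    rw [← sq_abs (V y - V x)]
    gcongr
  nlinarith [sq_nonneg (V y - 2 * V x)]

/-- A quantity comparable to the energy whose product with `(1 - t²)^(-1/2)` is almost constant
(the first WKB correction). -/
noncomputable def wkbEnergy (N c : ℝ) (V W : ℝ → ℝ) (t : ℝ) : ℝ :=
  W t ^ 2 + potential N c t * V t ^ 2 - t / (1 - t ^ 2) * (V t * W t)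
    + (1 / (1 - t ^ 2) + 3 * t ^ 2 / (1 - t ^ 2) ^ 2) / 2 * V t ^ 2

lemma hasDerivAt_wkbEnergy (h : IsSolution N c V W) {t : ℝ} (ht : 0 < t) (ht1 : t < 1) :
    HasDerivAt (wkbEnergy N c V W) (-(t / (1 - t ^ 2)) * wkbEnergy N c V W t
      + (-(2 * c / ((1 - t ^ 2) * t)) + 2 * c / t ^ 3
        + (9 * t / (1 - t ^ 2) ^ 2 + 15 * t ^ 3 / (1 - t ^ 2) ^ 3) / 2) * V t ^ 2) t := by
  have hQ : 1 - t ^ 2 ≠ 0 := by nlinarith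
  have h0 : HasDerivAt (fun t : ℝ => t ^ 2) (2 * t) t := by simpa using hasDerivAt_pow 2 t
  have hq := h0.const_sub 1
  have h1 := ((h.hasDerivAt_energy ht).fun_sub
    (((hasDerivAt_id' t).fun_div hq hQ).fun_mul (h.hasDerivAt_mul ht))).fun_add
    (((((hasDerivAt_const t (1 : ℝ)).fun_div hq hQ).fun_add
      ((h0.const_mul 3).fun_div (hq.fun_pow 2) (pow_ne_zero 2 hQ))).div_const 2).fun_mul
      (h.hasDerivAt_sq ht))
  refine h1.congr_deriv ?_
  simp only [wkbEnergy, potential]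
  field_simp
  ring

lemma le_wkbEnergy {t : ℝ} (ht1 : t ^ 2 < 1) :
    W t ^ 2 / 2 + potential N c t * V t ^ 2 ≤ wkbEnergy N c V W t := by
  have hQ : 0 < 1 - t ^ 2 := by linarith
  have h1 : wkbEnergy N c V W t = W t ^ 2 / 2 + potential N c t * V t ^ 2
      + ((W t - t / (1 - t ^ 2) * V t) ^ 2 / 2
        + (1 / (1 - t ^ 2) + 2 * t ^ 2 / (1 - t ^ 2) ^ 2) / 2 * V t ^ 2) := by
    unfold wkbEnergy
    field_simp
    ring
  rw [h1]
  have : 0 ≤ (W t - t / (1 - t ^ 2) * V t) ^ 2 / 2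
        + (1 / (1 - t ^ 2) + 2 * t ^ 2 / (1 - t ^ 2) ^ 2) / 2 * V t ^ 2 := by positivity
  linarith

end IsSolution

lemma le_potential {N c t : ℝ} (ht : 1 / 4 ≤ t) (h : 32 * |c| ≤ N ^ 2 * (1 - t ^ 2)) :
    N ^ 2 * (1 - t ^ 2) / 2 ≤ potential N c t := by
  have h2 : c / t ^ 2 ≤ 16 * |c| := by
    rw [div_le_iff₀ (by positivity)]
    have h16 : 1 ≤ 16 * t ^ 2 := by nlinarith
    nlinarith [abs_nonneg c, le_abs_self c]
  unfold potential
  linarith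

lemma potential_le {N c t : ℝ} (ht : 1 / 4 ≤ t) (h : 16 * |c| ≤ N ^ 2) :
    potential N c t ≤ 2 * N ^ 2 := by
  have h2 : -c / t ^ 2 ≤ 16 * |c| := by
    rw [div_le_iff₀ (by positivity)]
    have h16 : 1 ≤ 16 * t ^ 2 := by nlinarith
    nlinarith [abs_nonneg c, neg_le_abs c]
  unfold potential
  rw [neg_div] at h2
  nlinarith [sq_nonneg (N * t)]

lemma antitoneOn_potential {N c : ℝ} (h : 256 * |c| ≤ N ^ 2) :
    AntitoneOn (potential N c) (Ici (1 / 4)) := by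
  have hpos : ∀ x ∈ Ici (1 / 4 : ℝ), 0 < x := fun x hx => lt_of_lt_of_le (by norm_num) hx
  refine antitoneOn_of_hasDerivWithinAt_nonpos (convex_Ici _)
    (f' := fun t => -(2 * N ^ 2 * t) + 2 * c / t ^ 3)
    (fun x hx => (hasDerivAt_potential N c (hpos x hx).ne').continuousAt.continuousWithinAt)
    (fun x hx => (hasDerivAt_potential N c
      (hpos x (interior_subset hx)).ne').hasDerivWithinAt) ?_
  intro x hx
  have hx4 : 1 / 4 ≤ x := interior_subset hx
  have hx0 := hpos x hx4
  have h3 : 2 * c / x ^ 3 ≤ 2 * N ^ 2 * x := by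
    rw [div_le_iff₀ (by positivity)]
    have h4 : (1 / 4 : ℝ) ^ 4 ≤ x ^ 4 := by gcongr
    nlinarith [le_abs_self c, abs_nonneg c, sq_nonneg N]
  linarith

namespace IsSolution

variable {N c : ℝ} {V W : ℝ → ℝ}

lemma wkb_remainder_le {t : ℝ} (ht : 1 / 4 ≤ t) (ht1 : t < 1) :
    -(2 * c / ((1 - t ^ 2) * t)) + 2 * c / t ^ 3
        + (9 * t / (1 - t ^ 2) ^ 2 + 15 * t ^ 3 / (1 - t ^ 2) ^ 3) / 2
      ≤ (12 + 544 * |c|) * t / (1 - t ^ 2) ^ 3 := by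
  have ht0 : 0 < t := by linarith
  have hQ : 0 < 1 - t ^ 2 := by nlinarith
  have hQ1 : 1 - t ^ 2 ≤ 1 := by nlinarith
  set Q := 1 - t ^ 2 with hQd
  have hQ2 : Q ^ 2 ≤ 1 := by nlinarith
  have hQ3 : Q ^ 3 ≤ 1 := by nlinarith [mul_nonneg hQ.le (sub_nonneg.2 hQ2)]
  have a1 : -(2 * c / (Q * t)) ≤ 32 * |c| * t / Q ^ 3 := by
    rw [← neg_div, div_le_div_iff₀ (by positivity) (by positivity)]
    have e1 : -(2 * c) * Q ^ 3 ≤ 2 * |c| * Q ^ 3 := by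
      gcongr; linarith [neg_le_abs c]
    have e2 : 2 * |c| * Q ^ 3 ≤ 2 * |c| * Q := by
      gcongr; nlinarith
    have e3 : 2 * |c| * Q ≤ 32 * |c| * t * (Q * t) := by
      have : (1:ℝ) ≤ 16 * t ^ 2 := by nlinarith
      have := mul_le_mul_of_nonneg_left this (by positivity : 0 ≤ 2 * |c| * Q)
      linarith
    linarith
  have a2 : 2 * c / t ^ 3 ≤ 512 * |c| * t / Q ^ 3 := by
    rw [div_le_div_iff₀ (by positivity) (by positivity)]
    have e1 : (2 * c) * Q ^ 3 ≤ 2 * |c| * Q ^ 3 := by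
      gcongr; exact le_abs_self c
    have e2 : 2 * |c| * Q ^ 3 ≤ 2 * |c| * 1 := by
      gcongr
    have h4 : (1 / 4 : ℝ) ^ 4 ≤ t ^ 4 := by gcongr
    have e3 : 2 * |c| * 1 ≤ 512 * |c| * t * t ^ 3 := by
      nlinarith [abs_nonneg c]
    linarith
  have a3 : 9 * t / Q ^ 2 ≤ 9 * t / Q ^ 3 := by
    apply div_le_div_of_nonneg_left (by positivity) (by positivity)
    nlinarith [sq_nonneg Q]
  have a4 : 15 * t ^ 3 / Q ^ 3 ≤ 15 * t / Q ^ 3 := by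
    gcongr
    nlinarith
  have : (12 + 544 * |c|) * t / Q ^ 3 = 32 * |c| * t / Q ^ 3 + 512 * |c| * t / Q ^ 3
      + (9 * t / Q ^ 3 + 15 * t / Q ^ 3) / 2 := by ring
  linarith

/-- Up to the distance `N^(-2/3)` from the turning point, the corrected energy decays like
`(1 - t²)^(1/2)`. -/
lemma wkbEnergy_le (h : IsSolution N c V W) (hN : 1 ≤ N) (hc : 32 * |c| ≤ N) {r t : ℝ}
    (hr : 1 / 4 ≤ r) (hr2 : r ≤ 1 / 2) (hrt : r ≤ t) (ht1 : t < 1)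
    (ht : 1 ≤ N ^ 2 * (1 - t ^ 2) ^ 3) :
    wkbEnergy N c V W t
      ≤ 2 * exp (12 + 544 * |c|) * wkbEnergy N c V W r * √(1 - t ^ 2) := by
  set K := 12 + 544 * |c| with hK
  have hK0 : 0 ≤ K := by positivity
  have hN0 : 0 < N := by linarith
  have hpos : ∀ x ∈ Icc r t, 0 < x := fun x hx => by linarith [hx.1]
  have hlt : ∀ x ∈ Icc r t, x < 1 := fun x hx => hx.2.trans_lt ht1
  have hQ : ∀ x ∈ Icc r t, 0 < 1 - x ^ 2 := fun x hx => by
    nlinarith [hpos x hx, hlt x hx]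
  have hpot : ∀ x ∈ Icc r t, N ^ 2 * (1 - x ^ 2) / 2 ≤ potential N c x := by
    intro x hx
    refine le_potential (hr.trans hx.1) (hc.trans ?_)
    have e1 : 1 ≤ N ^ 2 * (1 - x ^ 2) ^ 3 := by
      refine ht.trans ?_
      have := hQ t ⟨hrt, le_rfl⟩
      have := hpos x hx
      have := hx.2
      gcongr
    have e2 : N ^ 3 ≤ (N ^ 2 * (1 - x ^ 2)) ^ 3 := by
      calc N ^ 3 ≤ N ^ 4 * 1 := by nlinarith [pow_pos hN0 3]
        _ ≤ N ^ 4 * (N ^ 2 * (1 - x ^ 2) ^ 3) := by gcongr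
        _ = _ := by ring
    have := hQ x hx
    exact le_of_pow_le_pow_left₀ (by norm_num) (by positivity) e2
  have hFlow : ∀ x ∈ Icc r t, N ^ 2 * (1 - x ^ 2) / 2 * V x ^ 2 ≤ wkbEnergy N c V W x := by
    intro x hx
    have e1 := le_wkbEnergy (N := N) (c := c) (V := V) (W := W) (t := x) (by linarith [hQ x hx])
    have e2 := mul_le_mul_of_nonneg_right (hpot x hx) (sq_nonneg (V x))
    nlinarith [sq_nonneg (W x)]
  let G : ℝ → ℝ := fun x => wkbEnergy N c V W x *
    exp (-(log (1 - x ^ 2) / 2) - K / (3 * N ^ 2) * (1 / (1 - x ^ 2) ^ 3))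
  have hG : ∀ x ∈ Icc r t, HasDerivAt G
      ((((-(2 * c / ((1 - x ^ 2) * x)) + 2 * c / x ^ 3
        + (9 * x / (1 - x ^ 2) ^ 2 + 15 * x ^ 3 / (1 - x ^ 2) ^ 3) / 2) * V x ^ 2)
        - 2 * K * x / (N ^ 2 * (1 - x ^ 2) ^ 4) * wkbEnergy N c V W x) *
        exp (-(log (1 - x ^ 2) / 2) - K / (3 * N ^ 2) * (1 / (1 - x ^ 2) ^ 3))) x := by
    intro x hx
    have hQx := (hQ x hx).ne'
    have h0 : HasDerivAt (fun t : ℝ => t ^ 2) (2 * x) x := by simpa using hasDerivAt_pow 2 x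
    have hq := h0.const_sub 1
    have h1 := (h.hasDerivAt_wkbEnergy (hpos x hx) (hlt x hx)).fun_mul
      ((((hq.log hQx).div_const 2).fun_neg.fun_sub
        (((hasDerivAt_const x (1 : ℝ)).fun_div (hq.fun_pow 3)
          (pow_ne_zero 3 hQx)).const_mul (K / (3 * N ^ 2)))).exp)
    refine h1.congr_deriv ?_
    generalize exp (-(log (1 - x ^ 2) / 2) - K / (3 * N ^ 2) * (1 / (1 - x ^ 2) ^ 3)) = Y
    generalize wkbEnergy N c V W x = F
    generalize (-(2 * c / ((1 - x ^ 2) * x)) + 2 * c / x ^ 3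
        + (9 * x / (1 - x ^ 2) ^ 2 + 15 * x ^ 3 / (1 - x ^ 2) ^ 3) / 2) = R
    field_simp
    push_cast
    ring
  have hanti : AntitoneOn G (Icc r t) := by
    refine antitoneOn_of_hasDerivWithinAt_nonpos (convex_Icc _ _)
      (fun x hx => (hG x hx).continuousAt.continuousWithinAt)
      (fun x hx => (hG x (interior_subset hx)).hasDerivWithinAt) ?_
    intro x hx
    replace hx := interior_subset hx
    have hx0 := hpos x hx
    have hQx := hQ x hx
    refine mul_nonpos_of_nonpos_of_nonneg ?_ (exp_pos _).le
    have e1 := mul_le_mul_of_nonneg_right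
      (wkb_remainder_le (c := c) (hr.trans hx.1) (hlt x hx)) (sq_nonneg (V x))
    have e2 : (12 + 544 * |c|) * x / (1 - x ^ 2) ^ 3 * V x ^ 2
        = 2 * K * x / (N ^ 2 * (1 - x ^ 2) ^ 4) * (N ^ 2 * (1 - x ^ 2) / 2 * V x ^ 2) := by
      rw [← hK]
      field_simp
    have e3 := mul_le_mul_of_nonneg_left (hFlow x hx)
      (by positivity : 0 ≤ 2 * K * x / (N ^ 2 * (1 - x ^ 2) ^ 4))
    linarith
  have hfin := hanti ⟨le_rfl, hrt⟩ ⟨hrt, le_rfl⟩ hrt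
  simp only [G] at hfin
  have hF : ∀ x ∈ Icc r t, 0 ≤ wkbEnergy N c V W x := fun x hx =>
    le_trans (by have := hQ x hx; positivity) (hFlow x hx)
  have hQr := hQ r ⟨le_rfl, hrt⟩
  have hQt := hQ t ⟨hrt, le_rfl⟩
  have hsq : exp (log (1 - t ^ 2) / 2) = √(1 - t ^ 2) := by
    rw [← Real.log_sqrt hQt.le, exp_log (Real.sqrt_pos.2 hQt)]
  have u1 : exp (-(log (1 - r ^ 2) / 2) - K / (3 * N ^ 2) * (1 / (1 - r ^ 2) ^ 3)) ≤ 2 := by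
    have e1 : -(log (1 - r ^ 2) / 2) - K / (3 * N ^ 2) * (1 / (1 - r ^ 2) ^ 3)
        ≤ -log √(1 - r ^ 2) := by
      rw [Real.log_sqrt hQr.le]
      have : 0 ≤ K / (3 * N ^ 2) * (1 / (1 - r ^ 2) ^ 3) := by positivity
      linarith
    refine (exp_le_exp.2 e1).trans ?_
    rw [exp_neg, exp_log (Real.sqrt_pos.2 hQr)]
    have e2 : (1 / 2 : ℝ) ≤ √(1 - r ^ 2) := Real.le_sqrt_of_sq_le (by nlinarith)
    rw [inv_le_comm₀ (by positivity) (by norm_num)]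
    linarith
  have u2 : exp (-(log (1 - t ^ 2) / 2) - K)
      ≤ exp (-(log (1 - t ^ 2) / 2) - K / (3 * N ^ 2) * (1 / (1 - t ^ 2) ^ 3)) := by
    apply exp_le_exp.2
    have : K / (3 * N ^ 2) * (1 / (1 - t ^ 2) ^ 3) ≤ K := by
      rw [div_mul_div_comm, div_le_iff₀ (by positivity)]
      nlinarith
    linarith
  have v1 := mul_le_mul_of_nonneg_left u1 (hF r ⟨le_rfl, hrt⟩)
  have v2 := mul_le_mul_of_nonneg_left u2 (hF t ⟨hrt, le_rfl⟩)
  have v3 := (v2.trans hfin).trans v1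
  calc wkbEnergy N c V W t = wkbEnergy N c V W t * exp (-(log (1 - t ^ 2) / 2) - K) *
        (exp K * exp (log (1 - t ^ 2) / 2)) := by
        rw [mul_assoc, ← exp_add, ← exp_add]
        ring_nf
        simp
    _ ≤ wkbEnergy N c V W r * 2 * (exp K * exp (log (1 - t ^ 2) / 2)) := by gcongr
    _ = _ := by rw [hsq]; ring

end IsSolution

lemma sub_one_le_of_potential_nonneg {ν c x : ℝ} (hν : 0 < ν) (hc : |c| ≤ ν ^ 4)
    (h : 0 ≤ potential (ν ^ 3) c x) : x - 1 ≤ (ν ^ 2)⁻¹ := by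
  have hinv0 : 0 < (ν ^ 2)⁻¹ := by positivity
  rcases le_total x 1 with hx1 | hx1
  · linarith
  have f1 : -c / x ^ 2 ≤ |c| := by
    rw [div_le_iff₀ (by positivity)]
    have : |c| * 1 ≤ |c| * x ^ 2 := by
      gcongr
      nlinarith
    linarith [neg_le_abs c]
  have f2 : 0 ≤ (ν ^ 3) ^ 2 * (1 - x ^ 2) + -c / x ^ 2 := by
    rw [neg_div]; unfold potential at h; linarith
  have f3 : (ν ^ 3) ^ 2 * (x - 1) ≤ (ν ^ 3) ^ 2 * (x ^ 2 - 1) := by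
    gcongr
    nlinarith
  rw [← one_div, le_div_iff₀ (by positivity)]
  have f4 : ν ^ 4 * ((x - 1) * ν ^ 2) ≤ ν ^ 4 * 1 := by linarith
  exact le_of_mul_le_mul_left f4 (by positivity)

namespace IsSolution

variable {N c : ℝ} {V W : ℝ → ℝ}

lemma exists_energy_le (h : IsSolution N c V W) (hN : 1 ≤ N) (hc : 16 * |c| ≤ N ^ 2) {J : ℝ}
    (hJ : 0 < J) (hVJ : ∫ t in (1 / 4)..(1 / 2), V t ^ 2 ≤ J) :
    ∃ r ∈ Icc (1 / 4 : ℝ) (1 / 2), W r ^ 2 + N ^ 2 * V r ^ 2 ≤ 40000 * N ^ 2 * J := by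
  by_contra! hcon
  set D := 40000 * N ^ 2 * J with hD
  have hpos : ∀ t ∈ Icc (1 / 4 : ℝ) (1 / 2), 0 < t := fun t ht => by linarith [ht.1]
  let χ : ℝ → ℝ := fun t => (t - 1 / 4) ^ 2 * (1 / 2 - t) ^ 2
  let χ' : ℝ → ℝ := fun t => 2 * (t - 1 / 4) * (1 / 2 - t) * (3 / 4 - 2 * t)
  let χ'' : ℝ → ℝ := fun t =>
    2 * (1 / 2 - t) ^ 2 - 8 * ((t - 1 / 4) * (1 / 2 - t)) + 2 * (t - 1 / 4) ^ 2
  let X : ℝ → ℝ := fun t =>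
    (t - 1 / 4) ^ 3 / 48 - (t - 1 / 4) ^ 4 / 8 + (t - 1 / 4) ^ 5 / 5
  let Φ : ℝ → ℝ := fun t => χ t * (V t * W t) - χ' t / 2 * V t ^ 2 - D * X t
  have hd : ∀ t : ℝ, HasDerivAt (fun t : ℝ => t - 1 / 4) 1 t := fun t =>
    (hasDerivAt_id t).sub_const _
  have hd' : ∀ t : ℝ, HasDerivAt (fun t : ℝ => 1 / 2 - t) (-1) t := fun t =>
    (hasDerivAt_id t).const_sub _
  have hχ : ∀ t, HasDerivAt χ (χ' t) t := fun t => by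
    refine (((hd t).fun_pow 2).fun_mul ((hd' t).fun_pow 2)).congr_deriv ?_
    simp [χ']
    ring
  have hχ' : ∀ t, HasDerivAt χ' (χ'' t) t := fun t => by
    refine ((((hd t).const_mul 2).fun_mul (hd' t)).fun_mul
      (((hasDerivAt_id' t).const_mul 2).const_sub (3 / 4))).congr_deriv ?_
    simp [χ'']
    ring
  have hX : ∀ t, HasDerivAt X (χ t) t := fun t => by
    refine (((((hd t).fun_pow 3).div_const 48).fun_sub (((hd t).fun_pow 4).div_const 8)).fun_add
      (((hd t).fun_pow 5).div_const 5)).congr_deriv ?_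
    simp [χ]
    ring
  have hΦ : ∀ t ∈ Icc (1 / 4 : ℝ) (1 / 2), HasDerivAt Φ
      (χ t * (W t ^ 2 - potential N c t * V t ^ 2) - χ'' t / 2 * V t ^ 2 - D * χ t) t := by
    intro t ht
    refine ((((hχ t).fun_mul (h.hasDerivAt_mul (hpos t ht))).fun_sub
      (((hχ' t).div_const 2).fun_mul (h.hasDerivAt_sq (hpos t ht)))).fun_sub
      ((hX t).const_mul D)).congr_deriv ?_
    ring
  have hcontV : ContinuousOn V (Icc (1 / 4) (1 / 2)) := fun t ht =>
    (h.left t (hpos t ht)).continuousAt.continuousWithinAt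
  have key := intervalIntegral.integral_le_sub_of_hasDeriv_right_of_le (a := (1 / 4 : ℝ))
    (b := 1 / 2) (g := Φ) (φ := fun t => -N ^ 2 * V t ^ 2) (by norm_num)
    (fun t ht => (hΦ t ht).continuousAt.continuousWithinAt)
    (fun t ht => (hΦ t (Ioo_subset_Icc_self ht)).hasDerivWithinAt)
    (ContinuousOn.integrableOn_Icc (by fun_prop)) (by
      intro t ht
      have ht' := Ioo_subset_Icc_self ht
      have h1 := (hcon t ht').le
      have hχ0 : 0 ≤ χ t := by positivity
      have hu : 0 ≤ t - 1 / 4 := by linarith [ht.1]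
      have hv : 0 ≤ 1 / 2 - t := by linarith [ht.2]
      have huv : 0 ≤ (t - 1 / 4) * (1 / 2 - t) := by positivity
      have huv' : (t - 1 / 4) * (1 / 2 - t) ≤ 1 / 64 := by nlinarith [sq_nonneg (t - 3 / 8)]
      have hχ1 : χ t ≤ 1 / 4096 := by
        have : χ t = ((t - 1 / 4) * (1 / 2 - t)) ^ 2 := by simp only [χ]; ring
        rw [this]
        nlinarith
      have hχ2 : χ'' t ≤ 1 / 8 := by
        simp only [χ'']
        nlinarith
      have hq := potential_le (N := N) (c := c) ht'.1 hc
      have e1 : χ t * D ≤ χ t * (W t ^ 2 + N ^ 2 * V t ^ 2) := by gcongr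
      have e2 : χ t * (N ^ 2 + potential N c t) ≤ 1 / 4096 * (3 * N ^ 2) :=
        calc _ ≤ χ t * (3 * N ^ 2) := by gcongr; linarith
          _ ≤ _ := by gcongr
      have e3 : χ t * (N ^ 2 + potential N c t) + χ'' t / 2 ≤ N ^ 2 := by nlinarith
      have e4 := mul_le_mul_of_nonneg_right e3 (sq_nonneg (V t))
      nlinarith)
  rw [intervalIntegral.integral_const_mul] at key
  have hval : Φ (1 / 2) - Φ (1 / 4) = -D / 30720 := by
    simp only [Φ, χ, χ', X]
    ring
  rw [hval, hD] at key
  have hN2 : 0 < N ^ 2 := by positivity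
  have := mul_le_mul_of_nonneg_left hVJ hN2.le
  nlinarith [mul_pos hN2 hJ]

lemma wkbEnergy_le_of_le_half (hN : 1 ≤ N) (hc : 16 * |c| ≤ N ^ 2) {r : ℝ}
    (hr : 1 / 4 ≤ r) (hr2 : r ≤ 1 / 2) :
    wkbEnergy N c V W r ≤ 4 * (W r ^ 2 + N ^ 2 * V r ^ 2) := by
  have hQ : 3 / 4 ≤ 1 - r ^ 2 := by nlinarith
  have hQ0 : 0 < 1 - r ^ 2 := by linarith
  have hq := potential_le (N := N) (c := c) hr hc
  have e1 : r / (1 - r ^ 2) ≤ 2 / 3 := by rw [div_le_iff₀ hQ0]; linarith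
  have e1' : 0 ≤ r / (1 - r ^ 2) := by positivity
  have e2 : 1 / (1 - r ^ 2) ≤ 4 / 3 := by rw [div_le_iff₀ hQ0]; linarith
  have e3 : 3 * r ^ 2 / (1 - r ^ 2) ^ 2 ≤ 4 / 3 := by
    rw [div_le_iff₀ (by positivity)]; nlinarith
  have f1 : -(r / (1 - r ^ 2) * (V r * W r)) ≤ 2 / 3 * ((V r ^ 2 + W r ^ 2) / 2) := by
    calc -(r / (1 - r ^ 2) * (V r * W r)) = r / (1 - r ^ 2) * (-(V r * W r)) := by ring
      _ ≤ r / (1 - r ^ 2) * ((V r ^ 2 + W r ^ 2) / 2) := by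
        gcongr
        nlinarith [sq_nonneg (V r + W r)]
      _ ≤ _ := by gcongr
  have f2 : (1 / (1 - r ^ 2) + 3 * r ^ 2 / (1 - r ^ 2) ^ 2) / 2 * V r ^ 2 ≤ 4 / 3 * V r ^ 2 :=
    mul_le_mul_of_nonneg_right (by linarith) (sq_nonneg _)
  have f3 : potential N c r * V r ^ 2 ≤ 2 * N ^ 2 * V r ^ 2 := by gcongr
  have f4 : V r ^ 2 ≤ N ^ 2 * V r ^ 2 := le_mul_of_one_le_left (sq_nonneg _) (by nlinarith)
  unfold wkbEnergy
  nlinarith [sq_nonneg (W r)]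

lemma sq_le_right_of_potential_neg (h : IsSolution N c V W)
    (hlim : Filter.Tendsto (fun t => V t * W t) Filter.atTop (nhds 0)) {a t : ℝ} (ha : 0 < a)
    (hq : ∀ x, a ≤ x → potential N c x ≤ 0) (hat : a ≤ t) : V t ^ 2 ≤ V a ^ 2 := by
  have hpos : ∀ x ∈ Ici a, 0 < x := fun x hx => ha.trans_le hx
  have hmono : MonotoneOn (fun t => V t * W t) (Ici a) := by
    refine monotoneOn_of_hasDerivWithinAt_nonneg (convex_Ici a)
      (fun x hx => (h.hasDerivAt_mul (hpos x hx)).continuousAt.continuousWithinAt)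
      (fun x hx => (h.hasDerivAt_mul (hpos x (interior_subset hx))).hasDerivWithinAt) ?_
    intro x hx
    nlinarith [hq x (interior_subset hx), sq_nonneg (V x), sq_nonneg (W x)]
  have hneg : ∀ x ∈ Ici a, V x * W x ≤ 0 := fun x hx =>
    ge_of_tendsto hlim (Filter.eventually_atTop.2
      ⟨x, fun y hy => hmono hx (le_trans hx hy : a ≤ y) hy⟩)
  have hanti : AntitoneOn (fun t => V t ^ 2) (Ici a) := by
    refine antitoneOn_of_hasDerivWithinAt_nonpos (convex_Ici a)
      (fun x hx => (h.hasDerivAt_sq (hpos x hx)).continuousAt.continuousWithinAt)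
      (fun x hx => (h.hasDerivAt_sq (hpos x (interior_subset hx))).hasDerivWithinAt) ?_
    intro x hx
    linarith [hneg x (interior_subset hx)]
  exact hanti self_mem_Ici hat hat

lemma sq_le_left_of_potential_neg (h : IsSolution N c V W)
    (hlim : Filter.Tendsto (fun t => V t * W t) (nhdsWithin 0 (Ioi 0)) (nhds 0)) {a t : ℝ}
    (ht : 0 < t) (hq : ∀ x, 0 < x → x ≤ a → potential N c x ≤ 0) (hat : t ≤ a) :
    V t ^ 2 ≤ V a ^ 2 := by
  have hmono : MonotoneOn (fun t => V t * W t) (Ioc 0 a) := by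
    refine monotoneOn_of_hasDerivWithinAt_nonneg (convex_Ioc 0 a)
      (fun x hx => (h.hasDerivAt_mul hx.1).continuousAt.continuousWithinAt)
      (fun x hx => (h.hasDerivAt_mul (interior_subset hx).1).hasDerivWithinAt) ?_
    intro x hx
    have hx' := interior_subset hx
    nlinarith [hq x hx'.1 hx'.2, sq_nonneg (V x), sq_nonneg (W x)]
  have hnn : ∀ x ∈ Ioc 0 a, 0 ≤ V x * W x := fun x hx =>
    le_of_tendsto hlim (by
      filter_upwards [Ioc_mem_nhdsGT hx.1] with y hy
      exact hmono ⟨hy.1, hy.2.trans hx.2⟩ hx hy.2)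
  have hmono' : MonotoneOn (fun t => V t ^ 2) (Ioc 0 a) := by
    refine monotoneOn_of_hasDerivWithinAt_nonneg (convex_Ioc 0 a)
      (fun x hx => (h.hasDerivAt_sq hx.1).continuousAt.continuousWithinAt)
      (fun x hx => (h.hasDerivAt_sq (interior_subset hx).1).hasDerivWithinAt) ?_
    intro x hx
    linarith [hnn x (interior_subset hx)]
  exact hmono' ⟨ht, hat⟩ ⟨ht.trans_le hat, le_rfl⟩ hat

lemma antitoneOn_energy (h : IsSolution N c V W) (hc : 256 * |c| ≤ N ^ 2) :
    AntitoneOn (fun t => W t ^ 2 + potential N c t * V t ^ 2) (Ici (1 / 4)) := by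
  have hpos : ∀ x ∈ Ici (1 / 4 : ℝ), 0 < x := fun x hx => lt_of_lt_of_le (by norm_num) hx
  refine antitoneOn_of_hasDerivWithinAt_nonpos (convex_Ici _)
    (fun x hx => (h.hasDerivAt_energy (hpos x hx)).continuousAt.continuousWithinAt)
    (fun x hx => (h.hasDerivAt_energy (hpos x (interior_subset hx))).hasDerivWithinAt) ?_
  intro x hx
  have hx4 : 1 / 4 ≤ x := interior_subset hx
  have hx0 := hpos x hx4
  have h3 : 2 * c / x ^ 3 ≤ 2 * N ^ 2 * x := by
    rw [div_le_iff₀ (by positivity)]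
    have h4 : (1 / 4 : ℝ) ^ 4 ≤ x ^ 4 := by gcongr
    nlinarith [le_abs_self c, abs_nonneg c, sq_nonneg N]
  exact mul_nonpos_of_nonpos_of_nonneg (by linarith) (sq_nonneg _)

lemma wkb_bound {ν : ℝ} (h : IsSolution (ν ^ 3) c V W) (hν : 2 + 64 * |c| ≤ ν) {A r x : ℝ}
    (hr : 1 / 4 ≤ r) (hr2 : r ≤ 1 / 2)
    (hE : 16 * exp (12 + 544 * |c|) * (W r ^ 2 + (ν ^ 3) ^ 2 * V r ^ 2) ≤ ν ^ 6 * A)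
    (hx : r ≤ x) (hx1 : x < 1) (hxQ : (ν ^ 2)⁻¹ ≤ 1 - x ^ 2) :
    V x ^ 2 ≤ A * ν ∧ W x ^ 2 + potential (ν ^ 3) c x * V x ^ 2
        ≤ A * ν ^ 6 * √(1 - x ^ 2) := by
  have hc0 := abs_nonneg c
  have hν2 : 2 ≤ ν := by linarith
  have hν0 : 0 < ν := by linarith
  have hA0 : 0 ≤ A := by
    have : 0 ≤ ν ^ 6 * A := le_trans (by positivity) hE
    exact nonneg_of_mul_nonneg_right this (by positivity)
  have hνN : 4 * ν ≤ ν ^ 3 := by nlinarith [mul_nonneg hν0.le (by nlinarith : 0 ≤ ν ^ 2 - 4)]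
  have hN1 : 1 ≤ ν ^ 3 := by linarith
  have hNN : ν ^ 3 ≤ (ν ^ 3) ^ 2 := by nlinarith
  have hinv0 : 0 < (ν ^ 2)⁻¹ := by positivity
  have hQ0 : 0 < 1 - x ^ 2 := hinv0.trans_le hxQ
  have hs : 0 < √(1 - x ^ 2) := Real.sqrt_pos.2 hQ0
  have hss : √(1 - x ^ 2) * √(1 - x ^ 2) = 1 - x ^ 2 := Real.mul_self_sqrt hQ0.le
  have hQ3 : 1 ≤ (ν ^ 3) ^ 2 * (1 - x ^ 2) ^ 3 := by
    calc (1 : ℝ) = (ν ^ 3) ^ 2 * ((ν ^ 2)⁻¹) ^ 3 := by field_simp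
      _ ≤ _ := by gcongr
  have e1 := h.wkbEnergy_le hN1 (by linarith) hr hr2 hx hx1 hQ3
  have e2 := wkbEnergy_le_of_le_half (c := c) (V := V) (W := W) hN1 (by linarith) hr hr2
  have e3 : wkbEnergy (ν ^ 3) c V W x ≤ A / 2 * ν ^ 6 * √(1 - x ^ 2) := by
    refine e1.trans ?_
    calc _ ≤ 2 * exp (12 + 544 * |c|) * (4 * (W r ^ 2 + (ν ^ 3) ^ 2 * V r ^ 2))
          * √(1 - x ^ 2) := by gcongr
      _ ≤ _ := mul_le_mul_of_nonneg_right (by linarith) hs.le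
  have e4 := le_wkbEnergy (N := ν ^ 3) (c := c) (V := V) (W := W) (t := x) (by linarith)
  have hν4 : 32 * |c| ≤ ν ^ 4 := by
    calc 32 * |c| ≤ ν * 1 := by linarith
      _ ≤ ν * ν ^ 3 := by gcongr
      _ = _ := by ring
  have hNQ : 32 * |c| ≤ (ν ^ 3) ^ 2 * (1 - x ^ 2) := by
    calc 32 * |c| ≤ ν ^ 4 := hν4
      _ = (ν ^ 3) ^ 2 * (ν ^ 2)⁻¹ := by field_simp
      _ ≤ _ := by gcongr
  have hq := le_potential (hr.trans hx) hNQ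
  have hq0 : 0 ≤ potential (ν ^ 3) c x := le_trans (by positivity) hq
  have hqV := mul_nonneg hq0 (sq_nonneg (V x))
  refine ⟨?_, by linarith⟩
  have e5 : ν ^ 6 * √(1 - x ^ 2) * (√(1 - x ^ 2) * V x ^ 2) ≤ ν ^ 6 * √(1 - x ^ 2) * A := by
    have := mul_le_mul_of_nonneg_right hq (sq_nonneg (V x))
    calc _ = ν ^ 6 * (√(1 - x ^ 2) * √(1 - x ^ 2)) * V x ^ 2 := by ring
      _ = 2 * ((ν ^ 3) ^ 2 * (1 - x ^ 2) / 2 * V x ^ 2) := by rw [hss]; ring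
      _ ≤ 2 * (A / 2 * ν ^ 6 * √(1 - x ^ 2)) := by linarith [sq_nonneg (W x)]
      _ = _ := by ring
  have e6 := le_of_mul_le_mul_left e5 (by positivity)
  have e7 : 1 ≤ ν * √(1 - x ^ 2) := by
    have : ν⁻¹ ≤ √(1 - x ^ 2) := Real.le_sqrt_of_sq_le (by rwa [inv_pow])
    calc (1 : ℝ) = ν * ν⁻¹ := by field_simp
      _ ≤ _ := by gcongr
  calc V x ^ 2 ≤ (ν * √(1 - x ^ 2)) * V x ^ 2 := le_mul_of_one_le_left (sq_nonneg _) e7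
    _ = ν * (√(1 - x ^ 2) * V x ^ 2) := by ring
    _ ≤ ν * A := by gcongr
    _ = _ := mul_comm _ _

lemma outer_bound {ν : ℝ} (h : IsSolution (ν ^ 3) c V W) (hν : 2 + 64 * |c| ≤ ν) {B r t : ℝ}
    (hB : 0 ≤ B) (hr : 1 / 4 ≤ r) (hr2 : r ≤ 1 / 2)
    (hE : W r ^ 2 + (ν ^ 3) ^ 2 * V r ^ 2 ≤ ν ^ 6 * B)
    (hlim : Filter.Tendsto (fun t => V t * W t) Filter.atTop (nhds 0)) (hrt : r ≤ t) :
    V t ^ 2 ≤ 160 * exp (12 + 544 * |c|) * B * ν := by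
  set A := 16 * exp (12 + 544 * |c|) * B with hA
  have hA0 : 0 ≤ A := by positivity
  have hc0 := abs_nonneg c
  have hν2 : 2 ≤ ν := by linarith
  have hν0 : 0 < ν := by linarith
  have hνN : 4 * ν ≤ ν ^ 3 := by nlinarith [mul_nonneg hν0.le (by nlinarith : 0 ≤ ν ^ 2 - 4)]
  have hN1 : 1 ≤ ν ^ 3 := by linarith
  have hNN : ν ^ 3 ≤ (ν ^ 3) ^ 2 := by nlinarith
  have hc1 : 32 * |c| ≤ ν ^ 3 := by linarith
  have hc2 : 256 * |c| ≤ (ν ^ 3) ^ 2 := by linarith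
  have hν4 : 32 * |c| ≤ ν ^ 4 := by
    calc 32 * |c| ≤ ν * 1 := by linarith
      _ ≤ ν * ν ^ 3 := by gcongr
      _ = _ := by ring
  have hQinv : (ν ^ 2)⁻¹ ≤ 1 / 4 := by
    rw [inv_le_comm₀ (by positivity) (by norm_num)]; nlinarith
  have hinv0 : 0 < (ν ^ 2)⁻¹ := by positivity
  -- the WKB region
  have hwkb : ∀ x, r ≤ x → x < 1 → (ν ^ 2)⁻¹ ≤ 1 - x ^ 2 →
      V x ^ 2 ≤ A * ν ∧ W x ^ 2 + potential (ν ^ 3) c x * V x ^ 2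
        ≤ A * ν ^ 6 * √(1 - x ^ 2) := by
    intro x hx hx1 hxQ
    refine h.wkb_bound hν hr hr2 ?_ hx hx1 hxQ
    calc _ ≤ 16 * exp (12 + 544 * |c|) * (ν ^ 6 * B) := by gcongr
      _ = _ := by rw [hA]; ring
  set t₁ := √(1 - (ν ^ 2)⁻¹) with ht₁
  have ht₁sq : t₁ ^ 2 = 1 - (ν ^ 2)⁻¹ := Real.sq_sqrt (by linarith)
  have ht₁half : 1 / 2 ≤ t₁ := Real.le_sqrt_of_sq_le (by norm_num; linarith)
  have ht₁lt : t₁ < 1 := by nlinarith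
  have hgap : 1 - t₁ ≤ (ν ^ 2)⁻¹ := by nlinarith
  have hAν : A * ν ≤ 10 * A * ν := by nlinarith [mul_nonneg hA0 hν0.le]
  have hgoal : 160 * exp (12 + 544 * |c|) * B * ν = 10 * A * ν := by rw [hA]; ring
  rw [hgoal]
  rcases le_total t t₁ with htt | htt
  · refine (hwkb t hrt (by linarith) ?_).1.trans hAν
    nlinarith
  have hq_anti := antitoneOn_potential hc2
  -- the region around the turning point
  have hmid : ∀ x, t₁ ≤ x → 0 ≤ potential (ν ^ 3) c x → V x ^ 2 ≤ 10 * A * ν := by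
    intro x hx hqx
    obtain ⟨w1, w2⟩ := hwkb t₁ (by linarith) ht₁lt (by linarith)
    have hsq : √(1 - t₁ ^ 2) = ν⁻¹ := by
      rw [ht₁sq, sub_sub_cancel, ← inv_pow, Real.sqrt_sq (by positivity)]
    have hw : W t₁ ^ 2 + potential (ν ^ 3) c t₁ * V t₁ ^ 2 ≤ A * ν ^ 5 := by
      refine w2.trans_eq ?_
      rw [hsq]
      field_simp
    have hx1 := sub_one_le_of_potential_nonneg hν0 (by linarith) hqx
    have hW : ∀ y ∈ Icc t₁ x, W y ^ 2 ≤ (√(A * ν ^ 5)) ^ 2 := by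
      intro y hy
      rw [Real.sq_sqrt (by positivity)]
      have m1 : (1 / 4 : ℝ) ≤ t₁ := by linarith
      have g1 := h.antitoneOn_energy hc2 (mem_Ici.2 m1) (mem_Ici.2 (m1.trans hy.1)) hy.1
      have g2 := hq_anti (mem_Ici.2 (m1.trans hy.1)) (mem_Ici.2 (m1.trans hx)) hy.2
      have g3 := mul_nonneg (hqx.trans g2) (sq_nonneg (V y))
      simp only at g1
      linarith
    have k1 := h.sq_le_of_sq_le (by linarith) (Real.sqrt_nonneg _) hW ⟨le_rfl, hx⟩ ⟨hx, le_rfl⟩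
    have k2 : (√(A * ν ^ 5) * |x - t₁|) ^ 2 ≤ 4 * (A * ν) := by
      rw [mul_pow, Real.sq_sqrt (by positivity), abs_of_nonneg (by linarith)]
      calc A * ν ^ 5 * (x - t₁) ^ 2 ≤ A * ν ^ 5 * (2 * (ν ^ 2)⁻¹) ^ 2 := by
            have : 0 ≤ x - t₁ := by linarith
            gcongr
            linarith
        _ = _ := by field_simp; norm_num
    linarith
  rcases le_total 0 (potential (ν ^ 3) c t) with hqt | hqt
  · exact hmid t htt hqt
  · have m1 : (1 / 4 : ℝ) ≤ t₁ := by linarith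
    have hq1 : 0 ≤ potential (ν ^ 3) c t₁ := by
      refine le_trans ?_ (le_potential m1 ?_)
      · rw [ht₁sq, sub_sub_cancel]; positivity
      · rw [ht₁sq, sub_sub_cancel]
        calc 32 * |c| ≤ ν ^ 4 := hν4
          _ = (ν ^ 3) ^ 2 * (ν ^ 2)⁻¹ := by field_simp
    have hcont : ContinuousOn (potential (ν ^ 3) c) (Icc t₁ t) := fun x hx =>
      (hasDerivAt_potential _ c
        (by linarith [hx.1] : 0 < x).ne').continuousAt.continuousWithinAt
    obtain ⟨a, ha, hqa⟩ := intermediate_value_Icc' htt hcont ⟨hqt, hq1⟩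
    refine (h.sq_le_right_of_potential_neg hlim (by linarith [ha.1]) ?_ ha.2).trans
      (hmid a ha.1 hqa.ge)
    intro x hx
    rw [← hqa]
    exact hq_anti (mem_Ici.2 (m1.trans ha.1)) (mem_Ici.2 (m1.trans (ha.1.trans hx))) hx

/-- Sonine's monotonicity argument. -/
lemma sonine_bound (h : IsSolution N c V W) {y r : ℝ} (hy : 0 < y) (hyr : y ≤ r)
    (hq : ∀ x ∈ Icc y r, 0 < potential N c x) (hq' : ∀ x ∈ Icc y r, c ≤ N ^ 2 * x ^ 4) :
    V y ^ 2 + W y ^ 2 / potential N c y ≤ V r ^ 2 + W r ^ 2 / potential N c r := by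
  have hd : ∀ x ∈ Icc y r, HasDerivAt (fun x => V x ^ 2 + W x ^ 2 / potential N c x)
      ((2 * N ^ 2 * x - 2 * c / x ^ 3) * W x ^ 2 / potential N c x ^ 2) x := by
    intro x hx
    have hx0 : 0 < x := hy.trans_le hx.1
    have hqx := (hq x hx).ne'
    refine ((h.hasDerivAt_sq hx0).fun_add (((h.right x hx0).fun_pow 2).fun_div
      (hasDerivAt_potential N c hx0.ne') hqx)).congr_deriv ?_
    generalize potential N c x = q at hqx
    field_simp
    simp
    ring
  have hmono : MonotoneOn (fun x => V x ^ 2 + W x ^ 2 / potential N c x) (Icc y r) := by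
    refine monotoneOn_of_hasDerivWithinAt_nonneg (convex_Icc _ _)
      (fun x hx => (hd x hx).continuousAt.continuousWithinAt)
      (fun x hx => (hd x (interior_subset hx)).hasDerivWithinAt) ?_
    intro x hx
    have hx' := interior_subset hx
    have hx0 : 0 < x := hy.trans_le hx'.1
    have : 2 * c / x ^ 3 ≤ 2 * N ^ 2 * x := by
      rw [div_le_iff₀ (by positivity)]
      linarith [hq' x hx']
    have := sub_nonneg.2 this
    positivity
  exact hmono ⟨le_rfl, hyr⟩ ⟨hyr, le_rfl⟩ hyr

/-- The region `(0, b]` where the potential increases. -/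
lemma sq_le_of_potential_increasing (h : IsSolution N c V W) (hcpos : 0 < c) (hN : 0 < N)
    (hc : 256 * c ≤ N ^ 2) {S b t : ℝ} (hS0 : 0 ≤ S) (hb1 : b ≤ 1 / 4)
    (hb4 : N ^ 2 * b ^ 4 = c) (hqb : 0 < potential N c b)
    (heb : W b ^ 2 + potential N c b * V b ^ 2 ≤ N ^ 2 * S)
    (hlim : Filter.Tendsto (fun t => V t * W t) (nhdsWithin 0 (Ioi 0)) (nhds 0))
    (ht : 0 < t) (htb : t ≤ b) :
    V t ^ 2 ≤ (16 + 8 * c) * S := by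
  have hb0 : 0 < b := ht.trans_le htb
  have hinc : ∀ x, 0 < x → x ≤ b → 0 ≤ -(2 * N ^ 2 * x) + 2 * c / x ^ 3 := by
    intro x hx hxb
    have : 2 * N ^ 2 * x ≤ 2 * c / x ^ 3 := by
      rw [le_div_iff₀ (by positivity), ← hb4]
      have : x ^ 4 ≤ b ^ 4 := by gcongr
      nlinarith
    linarith
  have hqmono : MonotoneOn (potential N c) (Ioc 0 b) := by
    refine monotoneOn_of_hasDerivWithinAt_nonneg (convex_Ioc 0 b)
      (fun x hx => (hasDerivAt_potential N c hx.1.ne').continuousAt.continuousWithinAt)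
      (fun x hx => (hasDerivAt_potential N c (interior_subset hx).1.ne').hasDerivWithinAt) ?_
    intro x hx
    exact hinc x (interior_subset hx).1 (interior_subset hx).2
  have hemono : MonotoneOn (fun t => W t ^ 2 + potential N c t * V t ^ 2) (Ioc 0 b) := by
    refine monotoneOn_of_hasDerivWithinAt_nonneg (convex_Ioc 0 b)
      (fun x hx => (h.hasDerivAt_energy hx.1).continuousAt.continuousWithinAt)
      (fun x hx => (h.hasDerivAt_energy (interior_subset hx).1).hasDerivWithinAt) ?_
    intro x hx
    exact mul_nonneg (hinc x (interior_subset hx).1 (interior_subset hx).2) (sq_nonneg _)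
  have hen : ∀ x, 0 < x → x ≤ b → W x ^ 2 + potential N c x * V x ^ 2 ≤ N ^ 2 * S :=
    fun x hx hxb => (hemono ⟨hx, hxb⟩ ⟨hb0, le_rfl⟩ hxb).trans heb
  -- below `b`, the potential stays large down to `z`
  set z := √(2 * c) / N with hz
  have hz0 : 0 < z := by positivity
  have hz2 : z ^ 2 = 2 * c / N ^ 2 := by rw [hz, div_pow, Real.sq_sqrt (by positivity)]
  have hlarge : ∀ x, z ≤ x → x ≤ b → V x ^ 2 ≤ 4 * S := by
    intro x hzx hxb
    have hx0 : 0 < x := hz0.trans_le hzx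
    have e1 : c / x ^ 2 ≤ N ^ 2 / 2 := by
      rw [div_le_iff₀ (by positivity)]
      have : z ^ 2 ≤ x ^ 2 := by gcongr
      rw [hz2, div_le_iff₀ (by positivity)] at this
      linarith
    have e2 : N ^ 2 / 4 ≤ potential N c x := by
      unfold potential
      have : x ^ 2 ≤ 1 / 4 := by nlinarith
      nlinarith
    have e3 := hen x hx0 hxb
    have e4 : N ^ 2 / 4 * V x ^ 2 ≤ N ^ 2 / 4 * (4 * S) := by
      have := mul_le_mul_of_nonneg_right e2 (sq_nonneg (V x))
      linarith [sq_nonneg (W x)]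
    exact le_of_mul_le_mul_left e4 (by positivity)
  have hzb : z ≤ b := by
    have : (z ^ 2) ^ 2 ≤ (b ^ 2) ^ 2 := by
      rw [hz2, div_pow, div_le_iff₀ (by positivity)]
      have : (b ^ 2) ^ 2 * (N ^ 2) ^ 2 = N ^ 2 * c := by rw [← hb4]; ring
      rw [this]
      nlinarith
    have := le_of_pow_le_pow_left₀ (by norm_num) (by positivity) this
    exact le_of_pow_le_pow_left₀ (by norm_num) hb0.le this
  have hsmall : ∀ x, 0 < x → x ≤ b → 0 ≤ potential N c x → V x ^ 2 ≤ (16 + 8 * c) * S := by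
    intro x hx hxb hqx
    rcases le_total z x with hzx | hxz
    · have := hlarge x hzx hxb
      nlinarith [mul_nonneg hcpos.le hS0]
    have hW : ∀ y ∈ Icc x z, W y ^ 2 ≤ (N * √S) ^ 2 := by
      intro y hy
      have hy0 := hx.trans_le hy.1
      have hyb := hy.2.trans hzb
      rw [mul_pow, Real.sq_sqrt hS0]
      have g1 := hen y hy0 hyb
      have g2 := hqmono ⟨hx, hxb⟩ ⟨hy0, hyb⟩ hy.1
      have g3 := mul_nonneg (hqx.trans g2) (sq_nonneg (V y))
      linarith
    have k1 := h.sq_le_of_sq_le hx (by positivity) hW ⟨hxz, le_rfl⟩ ⟨le_rfl, hxz⟩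
    have k2 := hlarge z le_rfl hzb
    have k3 : (N * √S * |x - z|) ^ 2 ≤ 2 * c * S := by
      rw [mul_pow, mul_pow, Real.sq_sqrt hS0, sq_abs]
      have : (x - z) ^ 2 ≤ z ^ 2 := by nlinarith
      calc N ^ 2 * S * (x - z) ^ 2 ≤ N ^ 2 * S * z ^ 2 := by gcongr
        _ = _ := by rw [hz2]; field_simp
    linarith [mul_nonneg hcpos.le hS0]
  rcases le_total 0 (potential N c t) with hqt | hqt
  · exact hsmall t ht htb hqt
  · have hcont : ContinuousOn (potential N c) (Icc t b) := fun x hx =>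
      (hasDerivAt_potential _ c (ht.trans_le hx.1).ne').continuousAt.continuousWithinAt
    obtain ⟨a, ha, hqa⟩ := intermediate_value_Icc htb hcont ⟨hqt, hqb.le⟩
    have ha0 : 0 < a := ht.trans_le ha.1
    refine (h.sq_le_left_of_potential_neg hlim ht ?_ ha.1).trans
      (hsmall a ha0 ha.2 hqa.ge)
    intro x hx hxa
    rw [← hqa]
    exact hqmono ⟨hx, hxa.trans ha.2⟩ ⟨ha0, ha.2⟩ hxa

lemma inner_bound (h : IsSolution N c V W) (hN : 1 ≤ N) (hc : 256 * |c| ≤ N) {B r t : ℝ}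
    (hr : 1 / 4 ≤ r) (hr2 : r ≤ 1 / 2)
    (hE : W r ^ 2 + N ^ 2 * V r ^ 2 ≤ N ^ 2 * B)
    (hlim : 0 < c → Filter.Tendsto (fun t => V t * W t) (nhdsWithin 0 (Ioi 0)) (nhds 0))
    (ht : 0 < t) (htr : t ≤ r) :
    V t ^ 2 ≤ (16 + 8 * |c|) * (4 * B) := by
  have hc0 := abs_nonneg c
  have hN0 : 0 < N := by linarith
  have hNN : N ≤ N ^ 2 := by nlinarith
  have hB : 0 ≤ B := by
    have : 0 ≤ N ^ 2 * B := le_trans (by positivity) hE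
    exact nonneg_of_mul_nonneg_right this (by positivity)
  have hqr : N ^ 2 / 3 ≤ potential N c r := by
    have h1 : 3 / 4 ≤ 1 - r ^ 2 := by nlinarith
    have h2 := le_potential (N := N) (c := c) hr (by nlinarith)
    nlinarith
  have hqr0 : 0 < potential N c r := lt_of_lt_of_le (by positivity) hqr
  have hf : V r ^ 2 + W r ^ 2 / potential N c r ≤ 4 * B := by
    have h1 : W r ^ 2 / potential N c r ≤ W r ^ 2 / (N ^ 2 / 3) := by gcongr
    have h2 : V r ^ 2 + W r ^ 2 / (N ^ 2 / 3) ≤ 3 * B := by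
      rw [← mul_le_mul_iff_right₀ (by positivity : 0 < N ^ 2), mul_add]
      have : N ^ 2 * (W r ^ 2 / (N ^ 2 / 3)) = 3 * W r ^ 2 := by field_simp
      rw [this]
      nlinarith [sq_nonneg (V r)]
    linarith
  set S := 4 * B with hS
  have hS0 : 0 ≤ S := by positivity
  have hSle : S ≤ (16 + 8 * |c|) * S := le_mul_of_one_le_left hS0 (by linarith)
  -- where the potential decreases
  have hdec : ∀ y, 0 < y → y ≤ r → c ≤ N ^ 2 * y ^ 4 →
      0 < potential N c y ∧ V y ^ 2 + W y ^ 2 / potential N c y ≤ S := by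
    intro y hy hyr hcy
    have hcx : ∀ x ∈ Icc y r, c ≤ N ^ 2 * x ^ 4 := fun x hx => hcy.trans (by
      have := hx.1; gcongr)
    have hanti : AntitoneOn (potential N c) (Icc y r) := by
      refine antitoneOn_of_hasDerivWithinAt_nonpos (convex_Icc _ _)
        (fun x hx => (hasDerivAt_potential N c
          (hy.trans_le hx.1).ne').continuousAt.continuousWithinAt)
        (fun x hx => (hasDerivAt_potential N c
          (hy.trans_le (interior_subset hx).1).ne').hasDerivWithinAt) ?_
      intro x hx
      have hx' := interior_subset hx
      have hx0 : 0 < x := hy.trans_le hx'.1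
      have : 2 * c / x ^ 3 ≤ 2 * N ^ 2 * x := by
        rw [div_le_iff₀ (by positivity)]
        linarith [hcx x hx']
      linarith
    have hq : ∀ x ∈ Icc y r, 0 < potential N c x := fun x hx =>
      hqr0.trans_le (hanti hx ⟨hyr, le_rfl⟩ hx.2)
    exact ⟨hq y ⟨le_rfl, hyr⟩, (h.sonine_bound hy hyr hq hcx).trans hf⟩
  by_cases hct : c ≤ N ^ 2 * t ^ 4
  · obtain ⟨h1, h2⟩ := hdec t ht htr hct
    have : 0 ≤ W t ^ 2 / potential N c t := by positivity
    linarith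
  rw [not_le] at hct
  have hcpos : 0 < c := lt_of_le_of_lt (by positivity) hct
  have habs : |c| = c := abs_of_pos hcpos
  rw [habs] at hc hSle ⊢
  -- the maximum `b` of the potential
  obtain ⟨b, hb0, hb4⟩ : ∃ b : ℝ, 0 < b ∧ N ^ 2 * b ^ 4 = c := by
    refine ⟨√(√(c / N ^ 2)), by positivity, ?_⟩
    have : √(√(c / N ^ 2)) ^ 4 = (√(√(c / N ^ 2)) ^ 2) ^ 2 := by ring
    rw [this, Real.sq_sqrt (by positivity), Real.sq_sqrt (by positivity)]
    field_simp
  have hb1 : b ≤ 1 / 4 := by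
    by_contra! hcon
    have : (1 / 4 : ℝ) ^ 4 < b ^ 4 := by gcongr
    nlinarith
  have hbr : b ≤ r := hb1.trans hr
  obtain ⟨hqb, hfb⟩ := hdec b hb0 hbr hb4.ge
  have htb : t < b := by
    by_contra! hcon
    have : b ^ 4 ≤ t ^ 4 := by gcongr
    nlinarith
  have hqbN : potential N c b ≤ N ^ 2 := by
    unfold potential
    have : 0 ≤ c / b ^ 2 := by positivity
    nlinarith [sq_nonneg (N * b)]
  have heb : W b ^ 2 + potential N c b * V b ^ 2 ≤ N ^ 2 * S := by
    calc _ = potential N c b * (V b ^ 2 + W b ^ 2 / potential N c b) := by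
          field_simp
          ring
      _ ≤ N ^ 2 * S := by gcongr
  exact h.sq_le_of_potential_increasing hcpos hN0 (by linarith) hS0 hb1 hb4 hqb heb
    (hlim hcpos) ht htb.le

/-- Uniform bound for solutions that are square integrable in the bulk. -/
lemma sq_le {ν : ℝ} (h : IsSolution (ν ^ 3) c V W) (hν : 2 + 64 * |c| ≤ ν) {J : ℝ} (hJ : 0 < J)
    (hVJ : ∫ t in (1 / 4)..(1 / 2), V t ^ 2 ≤ J)
    (htop : Filter.Tendsto (fun t => V t * W t) Filter.atTop (nhds 0))
    (hzero : 0 < c → Filter.Tendsto (fun t => V t * W t) (nhdsWithin 0 (Ioi 0)) (nhds 0))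
    {t : ℝ} (ht : 0 < t) :
    V t ^ 2 ≤ 40000 * (160 * exp (12 + 544 * |c|) + 64 + 32 * |c|) * J * ν := by
  have hc0 := abs_nonneg c
  have hν2 : 2 ≤ ν := by linarith
  have hνN : 4 * ν ≤ ν ^ 3 := by
    nlinarith [mul_nonneg (by linarith : 0 ≤ ν) (by nlinarith : 0 ≤ ν ^ 2 - 4)]
  have hNN : ν ^ 3 ≤ (ν ^ 3) ^ 2 := by nlinarith
  obtain ⟨r, hr, hE⟩ := h.exists_energy_le (by linarith) (by linarith) hJ hVJ
  have hE1 : W r ^ 2 + (ν ^ 3) ^ 2 * V r ^ 2 ≤ (ν ^ 3) ^ 2 * (40000 * J) := by linarith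
  have hexp := exp_pos (12 + 544 * |c|)
  rcases le_total t r with htr | htr
  · refine (h.inner_bound (by linarith) (by linarith) hr.1 hr.2 hE1 hzero ht htr).trans ?_
    have : (64 + 32 * |c|) * (40000 * J) * 1
        ≤ (160 * exp (12 + 544 * |c|) + 64 + 32 * |c|) * (40000 * J) * ν := by
      gcongr
      all_goals linarith
    linarith
  · refine (h.outer_bound hν (B := 40000 * J) (by positivity) hr.1 hr.2
      (hE1.trans_eq (by ring)) htop htr).trans ?_
    have : 160 * exp (12 + 544 * |c|) * (40000 * J) * ν
        ≤ (160 * exp (12 + 544 * |c|) + 64 + 32 * |c|) * (40000 * J) * ν := by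
      gcongr
      linarith
    linarith

end IsSolution

open Polynomial

lemma integrable_rpow_abs_mul_exp {a s : ℝ} (ha : -1 < a) (hs : 0 < s) :
    Integrable (fun x : ℝ => |x| ^ a * exp (-s * |x| ^ 2)) := by
  have hpos : IntegrableOn (fun x : ℝ => |x| ^ a * exp (-s * |x| ^ 2)) (Ioi 0) :=
    (integrableOn_rpow_mul_exp_neg_mul_sq hs ha).congr_fun
      (fun x hx => by simp only [abs_of_pos (mem_Ioi.1 hx)]) measurableSet_Ioi
  have hneg : IntegrableOn (fun x : ℝ => |x| ^ a * exp (-s * |x| ^ 2)) (Iic 0) := by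
    rw [← Measure.map_neg_eq_self (volume : Measure ℝ)]
    have m : MeasurableEmbedding fun x : ℝ => -x := (Homeomorph.neg ℝ).measurableEmbedding
    rw [m.integrableOn_map_iff]
    simp only [Function.comp_def, abs_neg, neg_preimage, neg_Iic, neg_zero]
    exact Iff.mpr integrableOn_Ici_iff_integrableOn_Ioi hpos
  rw [← integrableOn_univ, ← Iic_union_Ioi (a := (0 : ℝ))]
  exact hneg.union hpos

lemma integral_rpow_abs_mul_exp_add_two {a s : ℝ} (ha : -1 < a) (hs : 0 < s) :
    2 * s * ∫ x : ℝ, |x| ^ (a + 2) * exp (-s * |x| ^ 2)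
      = (a + 1) * ∫ x : ℝ, |x| ^ a * exp (-s * |x| ^ 2) := by
  have key : ∀ b : ℝ, -1 < b → ∫ x : ℝ, |x| ^ b * exp (-s * |x| ^ 2)
      = 2 * (s ^ (-(b + 1) / 2) * (1 / 2) * Gamma ((b + 1) / 2)) := by
    intro b hb
    rw [integral_comp_abs (f := fun y => y ^ b * exp (-s * y ^ 2)),
      ← integral_rpow_mul_exp_neg_mul_rpow two_pos hb hs]
    simp
  rw [key a ha, key (a + 2) (by linarith)]
  have e1 : (a + 2 + 1) / 2 = (a + 1) / 2 + 1 := by ring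
  have e2 : -(a + 2 + 1) / 2 = -(a + 1) / 2 - 1 := by ring
  rw [e1, e2, Gamma_add_one (by linarith), rpow_sub_one hs.ne']
  field_simp

lemma pow_mul_weight {σ s x : ℝ} (hx : x ≠ 0) {n : ℕ} (hn : Even n) :
    x ^ n * (|x| ^ (2 * σ) * exp (-s * x ^ 2))
      = |x| ^ ((n : ℝ) + 2 * σ) * exp (-s * |x| ^ 2) := by
  rw [rpow_add (abs_pos.2 hx), rpow_natCast, hn.pow_abs, sq_abs, mul_assoc]

lemma ae_ne_zero : ∀ᵐ x : ℝ, x ≠ 0 := by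
  simp [ae_iff]

lemma integrable_pow_mul_weight {σ s : ℝ} (hσ : -(1 / 2) < σ) (hs : 0 < s) (n : ℕ) :
    Integrable (fun x : ℝ => x ^ n * (|x| ^ (2 * σ) * exp (-s * x ^ 2))) := by
  have hn : (0 : ℝ) ≤ n := n.cast_nonneg
  refine (integrable_rpow_abs_mul_exp (a := n + 2 * σ) (by linarith) hs).mono'
    (by fun_prop) ?_
  filter_upwards [ae_ne_zero] with x hx
  rw [norm_mul, norm_mul, norm_pow, Real.norm_eq_abs, Real.norm_eq_abs, Real.norm_eq_abs,
    abs_of_nonneg (rpow_nonneg (abs_nonneg x) _), abs_of_pos (exp_pos _),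
    rpow_add (abs_pos.2 hx), rpow_natCast, sq_abs, mul_assoc]

lemma integrable_eval_mul_weight {σ s : ℝ} (hσ : -(1 / 2) < σ) (hs : 0 < s) (P : ℝ[X]) :
    Integrable (fun x : ℝ => P.eval x * (|x| ^ (2 * σ) * exp (-s * x ^ 2))) := by
  induction P using Polynomial.induction_on' with
  | add p q hp hq =>
    simp only [eval_add, add_mul]
    exact hp.add hq
  | monomial n a =>
    simpa [mul_assoc] using (integrable_pow_mul_weight hσ hs n).const_mul a

/-- The moment functional of the weight `|x|^(2σ) exp (-s x²)`. -/
lemma exists_moment_functional {σ s : ℝ} (hσ : -(1 / 2) < σ) (hs : 0 < s) :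
    ∃ I : ℝ[X] →ₗ[ℝ] ℝ,
      (∀ P : ℝ[X], I P = ∫ x : ℝ, P.eval x * (|x| ^ (2 * σ) * exp (-s * x ^ 2))) ∧
      (∀ n, Odd n → I (X ^ n) = 0) ∧
      ∀ n : ℕ, Even n → 2 * s * I (X ^ (n + 2)) = ((n : ℝ) + 1 + 2 * σ) * I (X ^ n) := by
  refine ⟨{ toFun := fun P => ∫ x : ℝ, P.eval x * (|x| ^ (2 * σ) * exp (-s * x ^ 2))
            map_add' := fun P Q => ?_
            map_smul' := fun a P => ?_ }, fun P => rfl, fun n hn => ?_, fun n hn => ?_⟩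
  · rw [← integral_add (integrable_eval_mul_weight hσ hs P) (integrable_eval_mul_weight hσ hs Q)]
    simp [add_mul]
  · simp [← integral_const_mul, mul_assoc]
  · simp only [LinearMap.coe_mk, AddHom.coe_mk, eval_pow, eval_X]
    have h := integral_neg_eq_self
      (fun x : ℝ => x ^ n * (|x| ^ (2 * σ) * exp (-s * x ^ 2))) volume
    simp only [hn.neg_pow, abs_neg, even_two.neg_pow, neg_mul, integral_neg] at h
    simp only [neg_mul]
    linarith
  · simp only [LinearMap.coe_mk, AddHom.coe_mk, eval_pow, eval_X]
    have hn0 : (0 : ℝ) ≤ n := n.cast_nonneg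
    have h1 : ∀ m : ℕ, Even m → ∫ x : ℝ, x ^ m * (|x| ^ (2 * σ) * exp (-s * x ^ 2))
        = ∫ x : ℝ, |x| ^ ((m : ℝ) + 2 * σ) * exp (-s * |x| ^ 2) := fun m hm =>
      integral_congr_ae (by filter_upwards [ae_ne_zero] with x hx using pow_mul_weight hx hm)
    rw [h1 n hn, h1 (n + 2) (hn.add even_two)]
    have h2 := integral_rpow_abs_mul_exp_add_two (a := n + 2 * σ) (by linarith) hs
    rw [show ((n + 2 : ℕ) : ℝ) + 2 * σ = n + 2 * σ + 2 by push_cast; ring, h2]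
    ring

/-- The coefficient produced by the square of the Dunkl operator on `X ^ n`. -/
noncomputable def dunklCoeff (σ : ℝ) (n : ℕ) : ℝ :=
  if Even n then n * (n - 1 + 2 * σ) else (n - 1) * (n + 2 * σ)

/-- The Dunkl form `T² - 2 s x d/dx` of the Hermite operator. -/
noncomputable def dunklHermite (σ s : ℝ) : ℝ[X] →ₗ[ℝ] ℝ[X] :=
  lsum fun n => dunklCoeff σ n • monomial (n - 2) - (2 * s * n) • monomial n

lemma dunklHermite_monomial (σ s : ℝ) (n : ℕ) (a : ℝ) :
    dunklHermite σ s (monomial n a)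
      = monomial (n - 2) (dunklCoeff σ n * a) - monomial n (2 * s * n * a) := by
  simp [dunklHermite, lsum_apply, sum_monomial_index, smul_monomial]

lemma dunklCoeff_of_lt_two (σ : ℝ) {n : ℕ} (hn : n < 2) : dunklCoeff σ n = 0 := by
  interval_cases n <;> simp [dunklCoeff]

lemma coeff_dunklHermite (σ s : ℝ) (P : ℝ[X]) (j : ℕ) :
    (dunklHermite σ s P).coeff j
      = dunklCoeff σ (j + 2) * P.coeff (j + 2) - 2 * s * j * P.coeff j := by
  induction P using Polynomial.induction_on' with
  | add p q hp hq => rw [map_add, coeff_add, hp, hq, coeff_add, coeff_add]; ring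
  | monomial n a =>
    rw [dunklHermite_monomial, coeff_sub]
    simp only [coeff_monomial]
    congr 1
    · rcases lt_or_ge n 2 with hn | hn
      · rw [dunklCoeff_of_lt_two σ hn, if_neg (by omega : ¬n = j + 2)]
        simp
      · by_cases h : n = j + 2
        · subst h; simp
        · rw [if_neg (by omega), if_neg h, mul_zero]
    · by_cases h : n = j
      · subst h; simp
      · simp [h]

section Functional

variable {σ s : ℝ} {I : ℝ[X] →ₗ[ℝ] ℝ}

lemma moment_symm (hodd : ∀ n, Odd n → I (X ^ n) = 0)
    (heven : ∀ n : ℕ, Even n → 2 * s * I (X ^ (n + 2)) = ((n : ℝ) + 1 + 2 * σ) * I (X ^ n))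
    (a b : ℕ) :
    dunklCoeff σ a * I (X ^ (a - 2 + b)) - 2 * s * a * I (X ^ (a + b))
      = dunklCoeff σ b * I (X ^ (a + (b - 2))) - 2 * s * b * I (X ^ (a + b)) := by
  have ha : dunklCoeff σ a * I (X ^ (a - 2 + b)) = dunklCoeff σ a * I (X ^ (a + b - 2)) := by
    rcases lt_or_ge a 2 with h | h
    · simp [dunklCoeff_of_lt_two σ h]
    · rw [show a - 2 + b = a + b - 2 by omega]
  have hb : dunklCoeff σ b * I (X ^ (a + (b - 2))) = dunklCoeff σ b * I (X ^ (a + b - 2)) := by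
    rcases lt_or_ge b 2 with h | h
    · simp [dunklCoeff_of_lt_two σ h]
    · rw [show a + (b - 2) = a + b - 2 by omega]
  rw [ha, hb]
  rcases lt_or_ge (a + b) 2 with h | h
  · have h1 : a < 2 := by omega
    have h2 : b < 2 := by omega
    rw [dunklCoeff_of_lt_two σ h1, dunklCoeff_of_lt_two σ h2]
    have hX : I X = 0 := by simpa using hodd 1 odd_one
    interval_cases a <;> interval_cases b <;> simp [hX] at h ⊢
  obtain ⟨n, hn⟩ := Nat.exists_eq_add_of_le' h
  rw [hn, Nat.add_sub_cancel]
  have hn' : (n : ℝ) = a + b - 2 := by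
    have : ((a + b : ℕ) : ℝ) = ((n + 2 : ℕ) : ℝ) := by rw [hn]
    push_cast at this
    linarith
  rcases Nat.even_or_odd n with he | ho
  · have hm := heven n he
    rw [hn'] at hm
    have hpar : Even a ↔ Even b := by
      rw [← Nat.even_add, hn]; exact he.add even_two
    by_cases hae : Even a
    · simp only [dunklCoeff, hae, hpar.1 hae, if_true]
      linear_combination (b - a : ℝ) * hm
    · simp only [dunklCoeff, hae, mt hpar.2 hae, if_false]
      linear_combination (b - a : ℝ) * hm
  · simp [hodd n ho, hodd (n + 2) (ho.add_even even_two)]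

lemma dunklHermite_symm (hodd : ∀ n, Odd n → I (X ^ n) = 0)
    (heven : ∀ n : ℕ, Even n → 2 * s * I (X ^ (n + 2)) = ((n : ℝ) + 1 + 2 * σ) * I (X ^ n))
    (P Q : ℝ[X]) : I (dunklHermite σ s P * Q) = I (P * dunklHermite σ s Q) := by
  induction P using Polynomial.induction_on' with
  | add p q hp hq => rw [map_add, add_mul, map_add, hp, hq, add_mul, map_add]
  | monomial a u =>
    induction Q using Polynomial.induction_on' with
    | add p q hp hq => rw [map_add, mul_add, map_add, hp, hq, mul_add, map_add]
    | monomial b v =>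
      have hI : ∀ n r, I (monomial n r) = r * I (X ^ n) := fun n r => by
        rw [← mul_one r, ← smul_eq_mul, ← smul_monomial, map_smul, monomial_one_right_eq_X_pow]
        simp
      simp only [dunklHermite_monomial, sub_mul, mul_sub, monomial_mul_monomial, map_sub, hI]
      linear_combination u * v * moment_symm hodd heven a b

variable {p : ℕ → ℝ[X]}

lemma degree_sub_lt (hdeg : ∀ k, (p k).degree = k) {n : ℕ}
    {Q : ℝ[X]} (hQ : Q.degree < (n + 1 : ℕ)) :
    (Q - C (Q.coeff n / (p n).coeff n) * p n).degree < n := by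
  have hn : (p n).coeff n ≠ 0 := coeff_ne_zero_of_eq_degree (hdeg n)
  rw [degree_lt_iff_coeff_zero]
  intro m hm
  rw [coeff_sub, coeff_C_mul]
  rcases hm.eq_or_lt with rfl | hm
  · field_simp
    ring
  · rw [coeff_eq_zero_of_degree_lt (hQ.trans_le (by exact_mod_cast hm)),
      coeff_eq_zero_of_degree_lt (by rw [hdeg]; exact_mod_cast hm : (p n).degree < m)]
    simp

lemma orthogonal_of_degree_lt (hdeg : ∀ k, (p k).degree = k)
    (horth : ∀ k l, I (p k * p l) = if k = l then 1 else 0) (n : ℕ) :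
    ∀ Q : ℝ[X], Q.degree < n → ∀ k, n ≤ k → I (p k * Q) = 0 := by
  induction n with
  | zero =>
    intro Q hQ k _
    have : Q = 0 := by
      rw [← degree_eq_bot]
      simpa [Nat.WithBot.lt_zero_iff] using hQ
    simp [this]
  | succ n ih =>
    intro Q hQ k hk
    have h := ih _ (degree_sub_lt hdeg hQ) k (by omega)
    rw [mul_sub, map_sub, mul_left_comm, ← smul_eq_C_mul, map_smul, horth,
      if_neg (by omega)] at h
    simpa using h

lemma dunklHermite_eq (hodd : ∀ n, Odd n → I (X ^ n) = 0)
    (heven : ∀ n : ℕ, Even n → 2 * s * I (X ^ (n + 2)) = ((n : ℝ) + 1 + 2 * σ) * I (X ^ n))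
    (hdeg : ∀ k, (p k).degree = k)
    (horth : ∀ k l, I (p k * p l) = if k = l then 1 else 0) (k : ℕ) :
    dunklHermite σ s (p k) + (2 * s * k) • p k = 0 := by
  set D := dunklHermite σ s (p k) + (2 * s * k) • p k with hD
  have hDdeg : D.degree < k := by
    rw [degree_lt_iff_coeff_zero]
    intro m hm
    rw [hD, coeff_add, coeff_smul, coeff_dunklHermite,
      coeff_eq_zero_of_degree_lt (by rw [hdeg]; exact_mod_cast (by omega : k < m + 2))]
    rcases hm.eq_or_lt with rfl | hm
    · simp
    · rw [coeff_eq_zero_of_degree_lt (by rw [hdeg]; exact_mod_cast hm)]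
      simp
  by_contra hne
  set d := D.natDegree with hd
  have hdk : d < k := (natDegree_lt_iff_degree_lt hne).2 hDdeg
  have hlow : (dunklHermite σ s (p d)).degree < k := by
    rw [degree_lt_iff_coeff_zero]
    intro m hm
    rw [coeff_dunklHermite,
      coeff_eq_zero_of_degree_lt (by rw [hdeg]; exact_mod_cast (by omega : d < m + 2)),
      coeff_eq_zero_of_degree_lt (by rw [hdeg]; exact_mod_cast (by omega : d < m))]
    simp
  have h1 : I (p d * D) = 0 := by
    rw [mul_comm, hD, add_mul, map_add, dunklHermite_symm hodd heven,
      orthogonal_of_degree_lt hdeg horth k _ hlow k le_rfl, smul_mul_assoc, map_smul, horth,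
      if_neg (by omega)]
    simp
  have h2 := orthogonal_of_degree_lt hdeg horth d _
    (degree_sub_lt hdeg (Q := D) (n := d)
      (by rw [degree_eq_natDegree hne]; exact_mod_cast Nat.lt_succ_self d)) d le_rfl
  rw [mul_sub, map_sub, mul_left_comm, ← smul_eq_C_mul, map_smul, horth, if_pos rfl, h1] at h2
  have h3 : D.coeff d ≠ 0 := by
    rw [hd, coeff_natDegree]; exact leadingCoeff_ne_zero.2 hne
  have h4 : (p d).coeff d ≠ 0 := coeff_ne_zero_of_eq_degree (hdeg d)
  have h5 := div_ne_zero h3 h4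
  simp at h2
  tauto

end Functional

lemma coeff_recurrence {σ s : ℝ} (hσ : -(1 / 2) < σ) (hs : 0 < s) {p : ℕ → ℝ[X]}
    (hdeg : ∀ k, (p k).degree = k)
    (horth : ∀ k l, (∫ x : ℝ, (p k).eval x * (p l).eval x * |x| ^ (2 * σ) * exp (-s * x ^ 2))
      = if k = l then 1 else 0) (k j : ℕ) :
    dunklCoeff σ (j + 2) * (p k).coeff (j + 2) = 2 * s * (j - k) * (p k).coeff j := by
  obtain ⟨I, hI, hodd, heven⟩ := exists_moment_functional hσ hs
  have horth' : ∀ k l, I (p k * p l) = if k = l then 1 else 0 := fun k l => by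
    rw [hI, ← horth]
    simp [mul_assoc]
  have h := congrArg (coeff · j) (dunklHermite_eq hodd heven hdeg horth' k)
  simp only [coeff_add, coeff_smul, coeff_dunklHermite, coeff_zero, smul_eq_mul] at h
  linarith

lemma coeff_eq_zero_of_parity {σ s : ℝ} (hs : 0 < s) {p : ℝ[X]} {k : ℕ} (hdeg : p.degree = k)
    (hrec : ∀ j : ℕ, dunklCoeff σ (j + 2) * p.coeff (j + 2) = 2 * s * (j - k) * p.coeff j)
    {j : ℕ} (hj : ¬Even (j + k)) : p.coeff j = 0 := by
  rcases lt_or_ge k j with h | h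
  · exact coeff_eq_zero_of_degree_lt (by rw [hdeg]; exact_mod_cast h)
  have hjk : j ≠ k := by rintro rfl; exact hj (Even.add_self j)
  have h1 : p.coeff (j + 2) = 0 :=
    coeff_eq_zero_of_parity hs hdeg hrec (by
      rw [Nat.even_iff] at hj ⊢
      omega)
  have h2 := hrec j
  rw [h1, mul_zero, zero_eq_mul] at h2
  have h3 : (j : ℝ) - k ≠ 0 := sub_ne_zero.2 (by exact_mod_cast hjk)
  exact h2.resolve_left (mul_ne_zero (by positivity) h3)
termination_by k - j
decreasing_by omega

/-- `p k = x ^ δ P` where `P` is even and solves the Hermite-type equation with parameter `σ + δ`;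
here `δ` is the remainder of `k` modulo 2. -/
lemma exists_even_part {σ s : ℝ} (hs : 0 < s) {p : ℝ[X]} {k : ℕ}
    (hdeg : p.degree = k)
    (hrec : ∀ j : ℕ, dunklCoeff σ (j + 2) * p.coeff (j + 2) = 2 * s * (j - k) * p.coeff j) :
    ∃ P : ℝ[X], p = X ^ (k % 2) * P ∧ (∀ x, P.eval (-x) = P.eval x) ∧
      ∀ x, x * (derivative (derivative P)).eval x
        + 2 * (σ + (k % 2 : ℕ)) * (derivative P).eval x - 2 * s * x ^ 2 * (derivative P).eval x
        + 2 * s * (k - (k % 2 : ℕ)) * x * P.eval x = 0 := by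
  have hpar := fun j => coeff_eq_zero_of_parity (j := j) hs hdeg hrec
  have hdvd : X ^ (k % 2) ∣ p := by
    rcases Nat.mod_two_eq_zero_or_one k with h | h
    · simp [h]
    · rw [h, pow_one, X_dvd_iff]
      exact hpar 0 (by simp [Nat.even_iff, h])
  obtain ⟨P, hP⟩ := hdvd
  have hcoeff : ∀ j, P.coeff j = p.coeff (j + k % 2) := fun j => by
    rw [hP, coeff_X_pow_mul]
  have hzero : ∀ j, Odd j → P.coeff j = 0 := fun j hj => by
    rw [hcoeff]
    exact hpar _ (by
      rw [Nat.odd_iff] at hj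
      rw [Nat.even_iff]
      omega)
  refine ⟨P, hP, fun x => ?_, fun x => ?_⟩
  · rw [eval_eq_sum_range, eval_eq_sum_range]
    refine Finset.sum_congr rfl fun j _ => ?_
    rcases Nat.even_or_odd j with hj | hj
    · rw [hj.neg_pow]
    · simp [hzero j hj]
  · have hpoly : X * derivative (derivative P) + C (2 * (σ + (k % 2 : ℕ))) * derivative P
        - C (2 * s) * (X * (X * derivative P)) + C (2 * s * (k - (k % 2 : ℕ))) * (X * P) = 0 := by
      ext j
      rcases j with _ | j
      · simp [coeff_derivative, hzero 1 odd_one]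
      · rcases Nat.even_or_odd j with hj | hj
        · have h := hrec (j + k % 2)
          rw [add_right_comm, ← hcoeff, ← hcoeff] at h
          have hXX : (X * derivative P).coeff j = j * P.coeff j := by
            rcases j with _ | j
            · simp
            · rw [coeff_X_mul, coeff_derivative]; push_cast; ring
          simp only [coeff_add, coeff_sub, coeff_C_mul, coeff_X_mul, coeff_derivative, hXX,
            coeff_zero]
          rcases Nat.mod_two_eq_zero_or_one k with hk | hk
          · rw [hk] at h ⊢
            rw [dunklCoeff, if_pos (by simpa using hj.add even_two)] at h
            push_cast at h ⊢
            linear_combination h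
          · rw [hk] at h ⊢
            rw [dunklCoeff, if_neg (by
              rw [Nat.even_iff] at hj ⊢
              omega)] at h
            push_cast at h ⊢
            linear_combination h
        · have hXX : (X * derivative P).coeff j = j * P.coeff j := by
            rcases j with _ | j
            · simp
            · rw [coeff_X_mul, coeff_derivative]; push_cast; ring
          simp only [coeff_add, coeff_sub, coeff_C_mul, coeff_X_mul, coeff_derivative, hXX,
            coeff_zero, hzero j hj, hzero (j + 1 + 1) (by
              rw [Nat.odd_iff] at hj ⊢
              omega)]
          simp
    have h := congrArg (eval x) hpoly
    simp only [eval_add, eval_sub, eval_mul, eval_X, eval_C, eval_zero] at h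
    linear_combination h

/-- The function `x ^ a P(x) exp (-s x² / 2)`. -/
noncomputable def profile (a s : ℝ) (P : ℝ[X]) (x : ℝ) : ℝ :=
  x ^ a * (P.eval x * exp (-s * x ^ 2 / 2))

/-- The polynomial `Q` with `(x ^ a P exp (-s x² / 2))' = x ^ (a - 1) Q exp (-s x² / 2)`. -/
noncomputable def profileDeriv (a s : ℝ) (P : ℝ[X]) : ℝ[X] :=
  C a * P + X * derivative P - C s * X ^ 2 * P

lemma hasDerivAt_profile (a s : ℝ) (P : ℝ[X]) {x : ℝ} (hx : 0 < x) :
    HasDerivAt (profile a s P) (profile (a - 1) s (profileDeriv a s P) x) x := by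
  have h1 : HasDerivAt (fun x : ℝ => x ^ a) (a * x ^ (a - 1)) x :=
    hasDerivAt_rpow_const (Or.inl hx.ne')
  have h2 : HasDerivAt (fun x : ℝ => -s * x ^ 2 / 2) (-s * x) x := by
    refine (((hasDerivAt_pow 2 x).const_mul (-s)).div_const 2).congr_deriv ?_
    push_cast
    ring
  refine (h1.mul ((P.hasDerivAt x).mul h2.exp)).congr_deriv ?_
  have h3 : x ^ a = x ^ (a - 1) * x := by
    rw [← rpow_add_one hx.ne', sub_add_cancel]
  simp only [Pi.mul_apply, profile, profileDeriv, eval_add, eval_sub, eval_mul, eval_C, eval_X,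
    eval_pow]
  rw [h3]
  ring

lemma tendsto_rpow_mul_eval_mul_exp_atTop (a : ℝ) {b : ℝ} (hb : 0 < b) (P : ℝ[X]) :
    Filter.Tendsto (fun x : ℝ => x ^ a * (P.eval x * exp (-b * x ^ 2))) Filter.atTop
      (nhds 0) := by
  induction P using Polynomial.induction_on' with
  | add p q hp hq =>
    simpa only [eval_add, add_mul, mul_add, add_zero] using hp.add hq
  | monomial n u =>
    have hexp : Filter.Tendsto (fun x : ℝ => exp (-(1 / 2) * x)) Filter.atTop (nhds 0) := by
      refine tendsto_exp_atBot.comp ?_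
      exact Filter.tendsto_id.const_mul_atTop_of_neg (by norm_num)
    have h := ((rpow_mul_exp_neg_mul_sq_isLittleO_exp_neg hb (a + n)).trans_tendsto
      hexp).const_mul u
    rw [mul_zero] at h
    refine h.congr' ?_
    filter_upwards [Filter.eventually_gt_atTop 0] with x hx
    rw [rpow_add hx, rpow_natCast, eval_monomial]
    ring

lemma exists_profile_sq_le {a s : ℝ} (ha : 0 ≤ a) (hs : 0 < s) (P : ℝ[X]) :
    ∃ B : ℝ, 0 ≤ B ∧ ∀ x, 0 < x → profile a s P x ^ 2 ≤ B := by
  have hcont : Continuous (profile a s P) := by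
    unfold profile
    exact (continuous_rpow_const ha).mul (P.continuous.mul (by fun_prop))
  have hlim : Filter.Tendsto (profile a s P) Filter.atTop (nhds 0) := by
    refine (tendsto_rpow_mul_eval_mul_exp_atTop a (half_pos hs) P).congr fun x => ?_
    rw [profile]
    ring_nf
  have hsq : Filter.Tendsto (fun x => profile a s P x ^ 2) Filter.atTop (nhds 0) := by
    simpa using hlim.pow 2
  obtain ⟨A, hA⟩ := Filter.eventually_atTop.1 (hsq.eventually_le_const one_pos)
  obtain ⟨B, hB⟩ := (isCompact_Icc (a := (0 : ℝ)) (b := A)).bddAbove_image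
    (hcont.pow 2).continuousOn
  refine ⟨max B 1, by positivity, fun x hx => ?_⟩
  rcases le_total A x with h | h
  · exact (hA x h).trans (le_max_right _ _)
  · exact (hB (mem_image_of_mem _ ⟨hx.le, h⟩)).trans (le_max_left _ _)

lemma profile_mul_profile (a s : ℝ) (P Q : ℝ[X]) {x : ℝ} (hx : 0 < x) :
    profile a s P x * profile (a - 1) s Q x
      = x ^ (2 * a - 1) * ((P * Q).eval x * exp (-s * x ^ 2)) := by
  have h1 : x ^ (2 * a - 1) = x ^ a * x ^ (a - 1) := by
    rw [← rpow_add hx]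
    ring_nf
  have h2 : exp (-s * x ^ 2) = exp (-s * x ^ 2 / 2) * exp (-s * x ^ 2 / 2) := by
    rw [← exp_add]
    ring_nf
  rw [h1, h2, profile, profile, eval_mul]
  ring

lemma eval_profileDeriv_profileDeriv {a s N : ℝ} {P : ℝ[X]}
    (hP : ∀ x, x * (derivative (derivative P)).eval x + 2 * a * (derivative P).eval x
      - 2 * s * x ^ 2 * (derivative P).eval x + s * (N - 1 - 2 * a) * x * P.eval x = 0) (x : ℝ) :
    (profileDeriv (a - 1) s (profileDeriv a s P)).eval x
      = (a * (a - 1) + s ^ 2 * x ^ 4 - s * N * x ^ 2) * P.eval x := by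
  simp only [profileDeriv, derivative_add, derivative_sub, derivative_mul, derivative_C,
    derivative_X, derivative_X_pow, eval_add, eval_sub, eval_mul, eval_C, eval_X, eval_pow,
    eval_zero, eval_one]
  simp
  linear_combination x * hP x

/-- The constant of the uniform estimate, as a function of a bound on the inverse-square
coefficient. -/
noncomputable def boundConst (c : ℝ) : ℝ :=
  40000 * (160 * exp (12 + 544 * c) + 64 + 32 * c)

lemma profile_sq_le {a s ν : ℝ} (ha : 0 ≤ a) (hs : 0 < s) {P : ℝ[X]}
    (hP : ∀ x, x * (derivative (derivative P)).eval x + 2 * a * (derivative P).eval x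
      - 2 * s * x ^ 2 * (derivative P).eval x + s * (ν ^ 3 - 1 - 2 * a) * x * P.eval x = 0)
    (hν : 2 + 64 * |a * (a - 1)| ≤ ν)
    (hint : IntegrableOn (fun x => profile a s P x ^ 2) (Ioi 0))
    (hnorm : ∫ x in Ioi (0 : ℝ), profile a s P x ^ 2 ≤ 1) {x : ℝ} (hx : 0 < x) :
    profile a s P x ^ 2 ≤ boundConst |a * (a - 1)| * (√(ν ^ 3 / s))⁻¹ * ν := by
  have hν0 : 0 < ν := by linarith [abs_nonneg (a * (a - 1))]
  set ρ := √(ν ^ 3 / s) with hρdef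
  have hρ : 0 < ρ := sqrt_pos.2 (by positivity)
  have hρ2 : s * ρ ^ 2 = ν ^ 3 := by
    rw [hρdef, sq_sqrt (by positivity)]
    field_simp
  set Q := profileDeriv a s P
  have hlin : ∀ t : ℝ, HasDerivAt (fun t => ρ * t) ρ t := fun t => by
    simpa using (hasDerivAt_id t).const_mul ρ
  have hprod : ∀ t, 0 < t → profile a s P (ρ * t) * (ρ * profile (a - 1) s Q (ρ * t))
      = ρ * ((ρ * t) ^ (2 * a - 1) * ((P * Q).eval (ρ * t) * exp (-s * (ρ * t) ^ 2))) :=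
    fun t ht => by
      rw [← profile_mul_profile a s P Q (mul_pos hρ ht)]
      ring
  have hsol : IsSolution (ν ^ 3) (a * (a - 1)) (fun t => profile a s P (ρ * t))
      (fun t => ρ * profile (a - 1) s Q (ρ * t)) := by
    constructor
    · intro t ht
      have h := (hasDerivAt_profile a s P (mul_pos hρ ht)).comp t (hlin t)
      exact h.congr_deriv (mul_comm _ _)
    · intro t ht
      have hpos := mul_pos hρ ht
      have h := ((hasDerivAt_profile (a - 1) s Q hpos).comp t (hlin t)).const_mul ρ
      refine h.congr_deriv ?_
      have h1 : (ρ * t) ^ a = (ρ * t) ^ (a - 1 - 1) * (ρ * t) ^ 2 := by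
        rw [← rpow_natCast, ← rpow_add hpos]
        congr 1
        push_cast
        ring
      simp only [profile]
      rw [eval_profileDeriv_profileDeriv hP, h1, potential, ← hρ2]
      field_simp
      ring
  have hmass : ∫ t in (1 / 4 : ℝ)..(1 / 2), profile a s P (ρ * t) ^ 2 ≤ ρ⁻¹ := by
    rw [intervalIntegral.integral_comp_mul_left (fun x => profile a s P x ^ 2) hρ.ne', smul_eq_mul]
    refine mul_le_of_le_one_right (by positivity) (le_trans ?_ hnorm)
    rw [intervalIntegral.integral_of_le (by gcongr; norm_num)]
    refine setIntegral_mono_set hint (Filter.Eventually.of_forall fun x => sq_nonneg _) ?_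
    exact LE.le.eventuallyLE fun x hx => lt_trans (by positivity) hx.1
  have htop : Filter.Tendsto
      (fun t => profile a s P (ρ * t) * (ρ * profile (a - 1) s Q (ρ * t)))
      Filter.atTop (nhds 0) := by
    have h := ((tendsto_rpow_mul_eval_mul_exp_atTop (2 * a - 1) hs (P * Q)).comp
      (Filter.tendsto_id.const_mul_atTop hρ)).const_mul ρ
    rw [mul_zero] at h
    refine h.congr' ?_
    filter_upwards [Filter.eventually_gt_atTop 0] with t ht
    exact (hprod t ht).symm
  have hzero : 0 < a * (a - 1) → Filter.Tendsto
      (fun t => profile a s P (ρ * t) * (ρ * profile (a - 1) s Q (ρ * t)))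
      (nhdsWithin 0 (Ioi 0)) (nhds 0) := by
    intro hc
    have ha1 : 1 < a := by
      have := pos_of_mul_pos_right hc ha
      linarith
    have hcont : Continuous fun t : ℝ =>
        ρ * ((ρ * t) ^ (2 * a - 1) * ((P * Q).eval (ρ * t) * exp (-s * (ρ * t) ^ 2))) := by
      refine continuous_const.mul (((continuous_rpow_const (by linarith)).comp
        (continuous_const.mul continuous_id)).mul (((P * Q).continuous.comp
        (continuous_const.mul continuous_id)).mul (by fun_prop)))
    have h := (hcont.tendsto 0).mono_left (nhdsWithin_le_nhds (s := Ioi (0 : ℝ)))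
    simp only [mul_zero, zero_rpow (by linarith : 2 * a - 1 ≠ 0), zero_mul] at h
    refine h.congr' ?_
    filter_upwards [self_mem_nhdsWithin] with t ht
    exact (hprod t ht).symm
  have hmain := hsol.sq_le hν (inv_pos.2 hρ) hmass htop hzero (div_pos hx hρ)
  simpa only [mul_div_cancel₀ x hρ.ne', boundConst] using hmain

lemma xiF_eq_profile {σ s : ℝ} {p : ℕ → ℝ[X]} {k d : ℕ} {P : ℝ[X]} (h : p k = X ^ d * P) {x : ℝ}
    (hx : 0 < x) : xiF σ s p k x = profile (σ + d) s P x := by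
  rw [xiF, profile, abs_of_pos hx, h, rpow_add hx, rpow_natCast, eval_mul, eval_pow, eval_X]
  ring

lemma xiF_neg_sq {σ s : ℝ} {p : ℕ → ℝ[X]} {k d : ℕ} {P : ℝ[X]} (h : p k = X ^ d * P)
    (hP : ∀ x, P.eval (-x) = P.eval x) (x : ℝ) : xiF σ s p k (-x) ^ 2 = xiF σ s p k x ^ 2 := by
  have hd : ((-x) ^ d) ^ 2 = (x ^ d) ^ 2 := by
    rw [← pow_mul, ← pow_mul, mul_comm, pow_mul, pow_mul, neg_sq]
  simp only [xiF, h, eval_mul, eval_pow, eval_X, hP, abs_neg, neg_sq, mul_pow, hd]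

lemma xiF_sq (σ s : ℝ) (p : ℕ → ℝ[X]) (k : ℕ) {x : ℝ} (hx : x ≠ 0) :
    xiF σ s p k x ^ 2 = (p k).eval x * (p k).eval x * |x| ^ (2 * σ) * exp (-s * x ^ 2) := by
  have h1 : |x| ^ (2 * σ) = |x| ^ σ * |x| ^ σ := by
    rw [← rpow_add (abs_pos.2 hx), two_mul]
  have h2 : exp (-s * x ^ 2) = exp (-s * x ^ 2 / 2) * exp (-s * x ^ 2 / 2) := by
    rw [← exp_add]
    ring_nf
  rw [h1, h2, xiF]
  ring

lemma forall_xiF_sq_le {σ s B : ℝ} {p : ℕ → ℝ[X]} {k d : ℕ} {P : ℝ[X]} (h : p k = X ^ d * P)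
    (hP : ∀ x, P.eval (-x) = P.eval x) (hB : ∀ x, 0 < x → profile (σ + d) s P x ^ 2 ≤ B)
    {x : ℝ} (hx : x ≠ 0) : xiF σ s p k x ^ 2 ≤ B := by
  have hpos : ∀ x, 0 < x → xiF σ s p k x ^ 2 ≤ B := fun x hx => by
    rw [xiF_eq_profile h hx]
    exact hB x hx
  rcases hx.lt_or_gt with hx | hx
  · rw [← xiF_neg_sq h hP]
    exact hpos _ (neg_pos.2 hx)
  · exact hpos _ hx

lemma integrable_xiF_sq {σ s : ℝ} {p : ℕ → ℝ[X]} {k : ℕ}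
    (horth : ∫ x : ℝ, (p k).eval x * (p k).eval x * |x| ^ (2 * σ) * exp (-s * x ^ 2) = 1) :
    Integrable (fun x => xiF σ s p k x ^ 2) ∧ ∫ x, xiF σ s p k x ^ 2 = 1 := by
  have h : ∫ x, xiF σ s p k x ^ 2 = 1 := by
    rw [← horth]
    refine integral_congr_ae ?_
    filter_upwards [ae_ne_zero] with x hx using xiF_sq σ s p k hx
  refine ⟨?_, h⟩
  by_contra hn
  rw [integral_undef hn] at h
  exact zero_ne_one h

end GeneralizedHermite

open GeneralizedHermite in
theorem xi_sq_le_of_odd_or_nonneg (σ s : ℝ) (hσ : -(1/2) < σ) (hs : 0 < s)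
    (p : ℕ → Polynomial ℝ)
    (hdeg : ∀ k, (p k).degree = k)
    (hlead : ∀ k, 0 < (p k).leadingCoeff)
    (horth : ∀ k l, (∫ x : ℝ,
        (p k).eval x * (p l).eval x * |x| ^ (2 * σ) * Real.exp (-s * x ^ 2)) =
        if k = l then 1 else 0) :
    ∃ C > (0 : ℝ), ∀ k : ℕ, 1 ≤ k → (Odd k ∨ 0 ≤ σ) → ∀ x : ℝ, x ≠ 0 →
      xiF σ s p k x ^ 2 ≤ C * (k : ℝ) ^ (-(1/6) : ℝ) := by
  have hpart := fun k => exists_even_part hs (hdeg k) (coeff_recurrence hσ hs hdeg horth k)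
  choose P hpP hPeven hPode using hpart
  have hindex : ∀ k : ℕ, (Odd k ∨ 0 ≤ σ) → 0 ≤ σ + (k % 2 : ℕ) := by
    rintro k (hk | hk)
    · rw [Nat.odd_iff.1 hk]
      push_cast
      linarith
    · positivity
  have hbdd : ∀ k : ℕ, ∃ B : ℝ, 0 ≤ B ∧
      ((Odd k ∨ 0 ≤ σ) → ∀ x : ℝ, x ≠ 0 → xiF σ s p k x ^ 2 ≤ B) := by
    intro k
    by_cases hk : Odd k ∨ 0 ≤ σ
    · obtain ⟨B, hB0, hB⟩ := exists_profile_sq_le (hindex k hk) hs (P k)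
      exact ⟨B, hB0, fun _ x hx => forall_xiF_sq_le (hpP k) (hPeven k) hB hx⟩
    · exact ⟨0, le_rfl, fun h => absurd h hk⟩
  choose B hB0 hB using hbdd
  set A := |σ * (σ - 1)| + |(σ + 1) * σ| with hA
  have hA0 : 0 ≤ A := by positivity
  have hcoeff : ∀ k : ℕ, |(σ + (k % 2 : ℕ)) * (σ + (k % 2 : ℕ) - 1)| ≤ A := by
    intro k
    rcases Nat.mod_two_eq_zero_or_one k with h | h <;> rw [h, hA]
    · simp [abs_mul, mul_nonneg]
    · simp [abs_mul, mul_nonneg]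
  obtain ⟨M, hM⟩ := exists_nat_ge ((2 + 64 * A) ^ 3)
  have hK : 0 < boundConst A := by
    unfold boundConst
    positivity
  have hsum0 : ∀ k, 0 ≤ B k * (k : ℝ) ^ (1 / 6 : ℝ) := fun k =>
    mul_nonneg (hB0 k) (by positivity)
  refine ⟨boundConst A * √s + ∑ k ∈ Finset.range M, B k * (k : ℝ) ^ (1 / 6 : ℝ),
    add_pos_of_pos_of_nonneg (by positivity) (Finset.sum_nonneg fun k _ => hsum0 k), ?_⟩
  intro k hk hkσ x hx
  have hk0 : (0 : ℝ) < k := by exact_mod_cast hk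
  rw [add_mul]
  rcases lt_or_ge k M with hkM | hkM
  · refine (hB k hkσ x hx).trans ?_
    have h1 : B k = B k * (k : ℝ) ^ (1 / 6 : ℝ) * (k : ℝ) ^ (-(1 / 6) : ℝ) := by
      rw [mul_assoc, ← rpow_add hk0]
      simp
    have h2 := Finset.single_le_sum (f := fun k : ℕ => B k * (k : ℝ) ^ (1 / 6 : ℝ))
      (fun k _ => hsum0 k) (Finset.mem_range.2 hkM)
    have h3 := mul_le_mul_of_nonneg_right h2 (by positivity : 0 ≤ (k : ℝ) ^ (-(1 / 6) : ℝ))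
    have h4 : 0 ≤ boundConst A * √s * (k : ℝ) ^ (-(1 / 6) : ℝ) := by positivity
    linarith
  set N : ℝ := 2 * k + 1 + 2 * σ with hN
  have hkN : (k : ℝ) ≤ N := by linarith
  have hN0 : 0 < N := hk0.trans_le hkN
  have hν3 : (N ^ (1 / 3 : ℝ)) ^ 3 = N := by
    rw [← rpow_natCast, ← rpow_mul hN0.le]
    norm_num
  have hν : 2 + 64 * A ≤ N ^ (1 / 3 : ℝ) := by
    refine le_of_pow_le_pow_left₀ three_ne_zero (by positivity) ?_
    rw [hν3]
    exact hM.trans ((by exact_mod_cast hkM : (M : ℝ) ≤ k).trans hkN)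
  obtain ⟨hint, hone⟩ := integrable_xiF_sq (by simpa using horth k k)
  have heq : ∀ y ∈ Ioi (0 : ℝ), xiF σ s p k y ^ 2
      = profile (σ + (k % 2 : ℕ)) s (P k) y ^ 2 := fun y hy => by
    rw [xiF_eq_profile (hpP k) hy]
  have hmain := fun y (hy : 0 < y) => profile_sq_le (ν := N ^ (1 / 3 : ℝ)) (hindex k hkσ) hs
    (P := P k)
    (fun y => by
      rw [hν3]
      linear_combination hPode k y)
    (le_trans (by linarith [hcoeff k]) hν)
    (hint.integrableOn.congr_fun heq measurableSet_Ioi)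
    (by
      rw [← setIntegral_congr_fun measurableSet_Ioi heq, ← hone]
      exact setIntegral_le_integral hint (Filter.Eventually.of_forall fun _ => sq_nonneg _))
    hy
  refine (forall_xiF_sq_le (hpP k) (hPeven k) hmain hx).trans ?_
  rw [hν3]
  have hexp : (√(N / s))⁻¹ * N ^ (1 / 3 : ℝ) = √s * N ^ (-(1 / 6) : ℝ) := by
    rw [sqrt_div hN0.le, inv_div, sqrt_eq_rpow N, div_mul_eq_mul_div, mul_div_assoc,
      ← rpow_sub hN0]
    norm_num
  have hmono : boundConst |(σ + (k % 2 : ℕ)) * (σ + (k % 2 : ℕ) - 1)| ≤ boundConst A := by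
    have := hcoeff k
    unfold boundConst
    gcongr
  have hpow : N ^ (-(1 / 6) : ℝ) ≤ (k : ℝ) ^ (-(1 / 6) : ℝ) :=
    rpow_le_rpow_of_nonpos hk0 hkN (by norm_num)
  have hrest : 0 ≤ (∑ k ∈ Finset.range M, B k * (k : ℝ) ^ (1 / 6 : ℝ))
      * (k : ℝ) ^ (-(1 / 6) : ℝ) :=
    mul_nonneg (Finset.sum_nonneg fun k _ => hsum0 k) (by positivity)
  calc _ = boundConst |(σ + (k % 2 : ℕ)) * (σ + (k % 2 : ℕ) - 1)|
        * (√s * N ^ (-(1 / 6) : ℝ)) := by rw [mul_assoc, hexp]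
    _ ≤ boundConst A * (√s * (k : ℝ) ^ (-(1 / 6) : ℝ)) := by gcongr
    _ ≤ _ := by linarith
end

section
/- Suppose σ < 0. There exists a constant C'' > 0, depending only on σ and s, such that for every even integer k ≥ 2, one has ξ_k(x)² ≤ C'' k^{−1/6} for all x with |x| ≥ x_{k,k/2}. -/
open MeasureTheory Real Set

/-- The potential of the Schrödinger equation satisfied by the generalized Hermite functions. -/
noncomputable def hermitePotential (s T τ x : ℝ) : ℝ := s ^ 2 * (T ^ 2 - x ^ 2) - τ / x ^ 2

/-- A solution `u` of `u'' + q u = 0` on the positive half-line, with `v = u'`, whose `L²` norm is at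
most one. -/
structure IsHermiteSolution (s T τ : ℝ) (u v : ℝ → ℝ) : Prop where
  s_pos : 0 < s
  T_pos : 0 < T
  tau_nonneg : 0 ≤ τ
  tau_le : τ ≤ 3 / 4
  four_le : 4 ≤ s * T ^ 2
  hasDerivAt_fst : ∀ x, 0 < x → HasDerivAt u (v x) x
  hasDerivAt_snd : ∀ x, 0 < x → HasDerivAt v (-hermitePotential s T τ x * u x) x
  mass_le : ∀ a b, 0 < a → a ≤ b → ∫ x in a..b, u x ^ 2 ≤ 1

namespace IsHermiteSolution

variable {s T τ : ℝ} {u v : ℝ → ℝ}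

lemma hasDerivAt_potential (s T τ : ℝ) {x : ℝ} (hx : 0 < x) :
    HasDerivAt (hermitePotential s T τ) (-2 * s ^ 2 * x + 2 * τ / x ^ 3) x := by
  have h1 := ((hasDerivAt_pow 2 x).const_sub (T ^ 2)).const_mul (s ^ 2)
  have h2 := (hasDerivAt_const x τ).fun_div (hasDerivAt_pow 2 x) (by positivity)
  refine (h1.fun_sub h2).congr_deriv ?_
  field_simp
  ring

/-- The commutator identity for a multiplier `f` with first three derivatives `f₁, f₂, f₃`. -/
lemma hasDerivAt_multiplier (H : IsHermiteSolution s T τ u v) {f f₁ f₂ : ℝ → ℝ} {f₃ x : ℝ}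
    (hx : 0 < x) (h0 : HasDerivAt f (f₁ x) x) (h1 : HasDerivAt f₁ (f₂ x) x)
    (h2 : HasDerivAt f₂ f₃ x) :
    HasDerivAt (fun x => f x * (v x ^ 2 + hermitePotential s T τ x * u x ^ 2) - f₁ x * (u x * v x)
        + f₂ x / 2 * u x ^ 2)
      ((2 * f₁ x * hermitePotential s T τ x + f x * (-2 * s ^ 2 * x + 2 * τ / x ^ 3) + f₃ / 2)
        * u x ^ 2) x := by
  have hu := H.hasDerivAt_fst x hx
  have hv := H.hasDerivAt_snd x hx
  have hq := hasDerivAt_potential s T τ hx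
  refine (((h0.fun_mul ((hv.fun_pow 2).fun_add (hq.fun_mul (hu.fun_pow 2)))).fun_sub
    (h1.fun_mul (hu.fun_mul hv))).fun_add ((h2.div_const 2).fun_mul (hu.fun_pow 2))).congr_deriv ?_
  simp only [Nat.cast_ofNat, Nat.add_one_sub_one, pow_one]
  ring

lemma continuousOn_fst (H : IsHermiteSolution s T τ u v) : ContinuousOn u (Ioi 0) :=
  fun x hx => (H.hasDerivAt_fst x hx).continuousAt.continuousWithinAt

lemma continuousOn_potential (s T τ : ℝ) : ContinuousOn (hermitePotential s T τ) (Ioi 0) :=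
  fun _ hx => (hasDerivAt_potential s T τ hx).continuousAt.continuousWithinAt

lemma intervalIntegrable_sq (H : IsHermiteSolution s T τ u v) {a b : ℝ} (ha : 0 < a)
    (hab : a ≤ b) : IntervalIntegrable (fun x => u x ^ 2) volume a b := by
  apply ContinuousOn.intervalIntegrable
  rw [uIcc_of_le hab]
  exact (H.continuousOn_fst.mono fun x hx => ha.trans_le hx.1).pow 2

lemma sixteen_le (H : IsHermiteSolution s T τ u v) : 16 ≤ s ^ 2 * T ^ 4 := by
  nlinarith [H.four_le]

lemma energy_le (H : IsHermiteSolution s T τ u v) {y : ℝ} (hy : 0 < y) (hyT : y ≤ T / 2) :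
    v y ^ 2 / 4 + hermitePotential s T τ y * u y ^ 2 ≤ 66 * s ^ 2 * T := by
  have hT := H.T_pos
  have hs := H.s_pos
  have hτ := H.tau_nonneg
  set B : ℝ → ℝ := fun x => (T - x) ^ 3 * (v x ^ 2 + hermitePotential s T τ x * u x ^ 2)
    - (-3 * (T - x) ^ 2) * (u x * v x) + (6 * (T - x)) / 2 * u x ^ 2 with hB
  have hlin : ∀ x, HasDerivAt (fun x : ℝ => T - x) (-1) x := fun x =>
    by simpa using (hasDerivAt_id x).const_sub T
  have hder : ∀ x, 0 < x → HasDerivAt B ((2 * (-3 * (T - x) ^ 2) * hermitePotential s T τ x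
      + (T - x) ^ 3 * (-2 * s ^ 2 * x + 2 * τ / x ^ 3) + (-6) / 2) * u x ^ 2) x := by
    intro x hx
    refine H.hasDerivAt_multiplier (f := fun x => (T - x) ^ 3) (f₁ := fun x => -3 * (T - x) ^ 2)
      (f₂ := fun x => 6 * (T - x)) hx ?_ ?_ ?_
    · exact ((hlin x).fun_pow 3).congr_deriv (by push_cast; ring)
    · exact (((hlin x).fun_pow 2).const_mul (-3)).congr_deriv (by push_cast; ring)
    · exact ((hlin x).const_mul 6).congr_deriv (by ring)
  have hbd : ∀ x ∈ Ioo y T, -((2 * (-3 * (T - x) ^ 2) * hermitePotential s T τ x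
      + (T - x) ^ 3 * (-2 * s ^ 2 * x + 2 * τ / x ^ 3) + (-6) / 2) * u x ^ 2)
      ≤ (8 * s ^ 2 * T ^ 4 + 3) * u x ^ 2 := by
    intro x hx
    have hx0 : 0 < x := hy.trans hx.1
    have hxT : 0 < T - x := sub_pos.2 hx.2
    rw [← neg_mul]
    refine mul_le_mul_of_nonneg_right ?_ (sq_nonneg _)
    have e1 : 0 ≤ τ / x ^ 2 := by positivity
    have e2 : 0 ≤ (T - x) ^ 3 * (2 * τ / x ^ 3) := by positivity
    have e3 : hermitePotential s T τ x ≤ s ^ 2 * T ^ 2 := by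
      unfold hermitePotential; nlinarith [mul_pos (pow_pos hs 2) (pow_pos hx0 2)]
    have e4 : (T - x) ^ 2 * hermitePotential s T τ x ≤ T ^ 2 * (s ^ 2 * T ^ 2) := by
      refine (mul_le_mul_of_nonneg_left e3 (sq_nonneg _)).trans ?_
      gcongr
      linarith
    have e5 : (T - x) ^ 3 * (s ^ 2 * x) ≤ T ^ 3 * (s ^ 2 * T) := by
      gcongr
      · linarith
      · exact hx.2.le
    nlinarith
  have hyT' : y ≤ T := by linarith
  have key := intervalIntegral.sub_le_integral_of_hasDeriv_right_of_le hyT'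
    (g := fun x => -B x) (φ := fun x => (8 * s ^ 2 * T ^ 4 + 3) * u x ^ 2)
    (fun x hx => (hder x (hy.trans_le hx.1)).fun_neg.continuousAt.continuousWithinAt)
    (fun x hx => (hder x (hy.trans hx.1)).fun_neg.hasDerivWithinAt)
    (((intervalIntegrable_iff_integrableOn_Icc_of_le hyT').1
      (H.intervalIntegrable_sq hy hyT')).const_mul _) hbd
  rw [intervalIntegral.integral_const_mul] at key
  have hBT : B T = 0 := by simp [hB]
  have hm := mul_le_mul_of_nonneg_left (H.mass_le y T hy hyT')
    (show 0 ≤ 8 * s ^ 2 * T ^ 4 + 3 by positivity)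
  have hBy : B y ≤ 8 * s ^ 2 * T ^ 4 + 3 := by simp only [hBT] at key; linarith
  set t := T - y with ht
  have ht2 : T / 2 ≤ t := by linarith
  have ht0 : 0 < t := by linarith
  set e := v y ^ 2 / 4 + hermitePotential s T τ y * u y ^ 2 with he
  have hlow : t ^ 3 * e ≤ B y := by
    have : B y - t ^ 3 * e = 3 * t * (u y + t * v y / 2) ^ 2 := by
      simp only [hB, he]; ring
    nlinarith [mul_nonneg ht0.le (sq_nonneg (u y + t * v y / 2))]
  by_contra! hcon
  have h3 : (T / 2) ^ 3 ≤ t ^ 3 := by gcongr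
  have : (T / 2) ^ 3 * (66 * s ^ 2 * T) < t ^ 3 * e := by
    calc (T / 2) ^ 3 * (66 * s ^ 2 * T) < (T / 2) ^ 3 * e := by gcongr
      _ ≤ t ^ 3 * e := by
        refine mul_le_mul_of_nonneg_right h3 (le_trans ?_ hcon.le)
        positivity
  nlinarith [H.sixteen_le]

lemma quarter_le_potential (H : IsHermiteSolution s T τ u v) {y : ℝ} (hyT : y ≤ T / 2)
    (hy : √(2 * τ) / (s * T) ≤ y) (hy0 : 0 < y) :
    s ^ 2 * T ^ 2 / 4 ≤ hermitePotential s T τ y := by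
  have hT := H.T_pos
  have hs := H.s_pos
  have h1 : 2 * τ ≤ y ^ 2 * (s * T) ^ 2 := by
    rw [div_le_iff₀ (by positivity)] at hy
    calc 2 * τ = √(2 * τ) ^ 2 := (sq_sqrt (by linarith [H.tau_nonneg])).symm
      _ ≤ (y * (s * T)) ^ 2 := by gcongr
      _ = _ := by ring
  have h2 : τ / y ^ 2 ≤ s ^ 2 * T ^ 2 / 2 := by
    rw [div_le_iff₀ (by positivity)]; nlinarith
  have h3 : y ^ 2 ≤ (T / 2) ^ 2 := by gcongr
  unfold hermitePotential
  nlinarith [mul_le_mul_of_nonneg_left h3 (sq_nonneg s)]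

lemma potential_identity (s T τ : ℝ) {x y z : ℝ} (hx : 0 < x) (hy : 0 < y) (hz : 0 < z) :
    (z ^ 2 - x ^ 2) * (y ^ 2 * hermitePotential s T τ y) =
      (z ^ 2 - y ^ 2) * (x ^ 2 * hermitePotential s T τ x)
      + (y ^ 2 - x ^ 2) * (z ^ 2 * hermitePotential s T τ z)
      + s ^ 2 * ((z ^ 2 - x ^ 2) * ((y ^ 2 - x ^ 2) * (z ^ 2 - y ^ 2))) := by
  unfold hermitePotential
  field_simp
  ring

lemma potential_nonneg_of_mem {x y z : ℝ} (hx : 0 < x) (hxy : x ≤ y) (hyz : y ≤ z)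
    (h1 : 0 ≤ hermitePotential s T τ x) (h2 : 0 ≤ hermitePotential s T τ z) :
    0 ≤ hermitePotential s T τ y := by
  rcases hxy.eq_or_lt with rfl | hxy
  · exact h1
  have hy : 0 < y := hx.trans hxy
  have a : 0 < y ^ 2 - x ^ 2 := sub_pos.2 (by gcongr)
  have b : 0 ≤ z ^ 2 - y ^ 2 := sub_nonneg.2 (by gcongr)
  have c : 0 < z ^ 2 - x ^ 2 := by linarith
  have key := potential_identity s T τ hx hy (hy.trans_le hyz)
  have : 0 ≤ (z ^ 2 - x ^ 2) * (y ^ 2 * hermitePotential s T τ y) := by rw [key]; positivity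
  exact nonneg_of_mul_nonneg_right (nonneg_of_mul_nonneg_right this c) (by positivity)

lemma potential_pos_of_mem {x y z : ℝ} (hx : 0 < x) (hxy : x ≤ y) (hyz : y ≤ z)
    (h1 : 0 < hermitePotential s T τ x) (h2 : 0 < hermitePotential s T τ z) :
    0 < hermitePotential s T τ y := by
  rcases hxy.eq_or_lt with rfl | hxy
  · exact h1
  have hy : 0 < y := hx.trans hxy
  have hz : 0 < z := hy.trans_le hyz
  have a : 0 < y ^ 2 - x ^ 2 := sub_pos.2 (by gcongr)
  have b : 0 ≤ z ^ 2 - y ^ 2 := sub_nonneg.2 (by gcongr)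
  have c : 0 < z ^ 2 - x ^ 2 := by linarith
  have key := potential_identity s T τ hx hy hz
  have : 0 < (z ^ 2 - x ^ 2) * (y ^ 2 * hermitePotential s T τ y) := by rw [key]; positivity
  exact pos_of_mul_pos_right (pos_of_mul_pos_right this c.le) (by positivity)

lemma sq_le_of_bulk (H : IsHermiteSolution s T τ u v) {y : ℝ} (hyT : y ≤ T / 2)
    (hy : √(2 * τ) / (s * T) ≤ y) (hy0 : 0 < y) : u y ^ 2 ≤ 264 / T := by
  have hT := H.T_pos
  have hs := H.s_pos
  have h1 := H.energy_le hy0 hyT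
  have h2 := mul_le_mul_of_nonneg_right (H.quarter_le_potential hyT hy hy0) (sq_nonneg (u y))
  have h3 : s ^ 2 * T * (T * u y ^ 2) ≤ s ^ 2 * T * 264 := by nlinarith [sq_nonneg (v y)]
  rw [le_div_iff₀ hT, mul_comm]
  exact le_of_mul_le_mul_left h3 (by positivity)

lemma inner_le (H : IsHermiteSolution s T τ u v) : √(2 * τ) / (s * T) ≤ T / 2 := by
  have hT := H.T_pos
  have hs := H.s_pos
  rw [div_le_iff₀ (by positivity), sqrt_le_left (by positivity)]
  nlinarith [H.tau_le, H.four_le]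

lemma sq_le_of_inner (H : IsHermiteSolution s T τ u v) {y : ℝ} (hy0 : 0 < y)
    (hy : y ≤ √(2 * τ) / (s * T)) (hq : 0 ≤ hermitePotential s T τ y) : u y ^ 2 ≤ 1320 / T := by
  have hT := H.T_pos
  have hs := H.s_pos
  set y₁ := √(2 * τ) / (s * T) with hy₁
  have hy₁0 : 0 < y₁ := hy0.trans_le hy
  have hq₁ : 0 ≤ hermitePotential s T τ y₁ :=
    le_trans (by positivity) (H.quarter_le_potential H.inner_le le_rfl hy₁0)
  have hv : ∀ z ∈ Icc y y₁, ‖v z‖ ≤ √(264 * s ^ 2 * T) := by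
    intro z hz
    have hz0 := hy0.trans_le hz.1
    rw [norm_eq_abs]
    apply abs_le_sqrt
    have := H.energy_le hz0 (hz.2.trans H.inner_le)
    have := mul_nonneg (potential_nonneg_of_mem hy0 hz.1 hz.2 hq hq₁) (sq_nonneg (u z))
    linarith
  have hd := (convex_Icc y y₁).norm_image_sub_le_of_norm_hasDerivWithin_le
    (fun z hz => (H.hasDerivAt_fst z (hy0.trans_le hz.1)).hasDerivWithinAt) hv
    (left_mem_Icc.2 hy) (right_mem_Icc.2 hy)
  rw [norm_eq_abs, norm_eq_abs, abs_of_nonneg (sub_nonneg.2 hy)] at hd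
  have hd2 : (u y₁ - u y) ^ 2 ≤ 396 / T := by
    calc (u y₁ - u y) ^ 2 = |u y₁ - u y| ^ 2 := (sq_abs _).symm
      _ ≤ (√(264 * s ^ 2 * T) * y₁) ^ 2 := by gcongr; refine hd.trans ?_; gcongr; linarith
      _ = 264 * s ^ 2 * T * (2 * τ / (s * T) ^ 2) := by
        rw [mul_pow, sq_sqrt (by positivity), hy₁, div_pow,
          sq_sqrt (by linarith [H.tau_nonneg])]
      _ = 528 * τ / T := by field_simp; ring
      _ ≤ 396 / T := by gcongr; linarith [H.tau_le]
  have hb := H.sq_le_of_bulk H.inner_le le_rfl hy₁0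
  calc u y ^ 2 ≤ 2 * u y₁ ^ 2 + 2 * (u y₁ - u y) ^ 2 := by
        nlinarith [sq_nonneg (2 * u y₁ - u y)]
    _ ≤ 2 * (264 / T) + 2 * (396 / T) := by gcongr
    _ = 1320 / T := by ring

lemma hasDerivAt_sq (H : IsHermiteSolution s T τ u v) {x : ℝ} (hx : 0 < x) :
    HasDerivAt (fun x => u x ^ 2) (2 * (u x * v x)) x :=
  ((H.hasDerivAt_fst x hx).fun_pow 2).congr_deriv (by push_cast; ring)

lemma hasDerivAt_mul (H : IsHermiteSolution s T τ u v) {x : ℝ} (hx : 0 < x) :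
    HasDerivAt (fun x => u x * v x) (v x ^ 2 - hermitePotential s T τ x * u x ^ 2) x :=
  ((H.hasDerivAt_fst x hx).fun_mul (H.hasDerivAt_snd x hx)).congr_deriv (by ring)

/-- `u * u'` is monotone where the potential is nonpositive. -/
lemma monotoneOn_mul (H : IsHermiteSolution s T τ u v) {D : Set ℝ} (hD : Convex ℝ D)
    (hpos : ∀ x ∈ D, 0 < x) (hq : ∀ x ∈ D, hermitePotential s T τ x ≤ 0) :
    MonotoneOn (fun x => u x * v x) D := by
  refine monotoneOn_of_hasDerivWithinAt_nonneg hD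
    (fun x hx => (H.hasDerivAt_mul (hpos x hx)).continuousAt.continuousWithinAt)
    (fun x hx => (H.hasDerivAt_mul (hpos x (interior_subset hx))).hasDerivWithinAt) fun x hx => ?_
  nlinarith [mul_nonneg (neg_nonneg.2 (hq x (interior_subset hx))) (sq_nonneg (u x)),
    sq_nonneg (v x)]

lemma monotoneOn_sq (H : IsHermiteSolution s T τ u v) {D : Set ℝ} (hD : Convex ℝ D)
    (hpos : ∀ x ∈ D, 0 < x) (hmul : ∀ x ∈ D, 0 ≤ u x * v x) :
    MonotoneOn (fun x => u x ^ 2) D :=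
  monotoneOn_of_hasDerivWithinAt_nonneg hD
    (fun x hx => (H.hasDerivAt_sq (hpos x hx)).continuousAt.continuousWithinAt)
    (fun x hx => (H.hasDerivAt_sq (hpos x (interior_subset hx))).hasDerivWithinAt)
    fun x hx => mul_nonneg zero_le_two (hmul x (interior_subset hx))

lemma sq_le_of_zero (H : IsHermiteSolution s T τ u v) {r y z : ℝ} (hr : 0 < r) (hur : u r = 0)
    (hry : r ≤ y) (hyz : y ≤ z) (hq : ∀ x ∈ Icc r z, hermitePotential s T τ x ≤ 0) :
    u y ^ 2 ≤ u z ^ 2 := by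
  have hpos : ∀ x ∈ Icc r z, 0 < x := fun x hx => hr.trans_le hx.1
  have hm := H.monotoneOn_mul (convex_Icc r z) hpos hq
  have h0 : ∀ x ∈ Icc r z, 0 ≤ u x * v x := fun x hx => by
    simpa [hur] using hm (left_mem_Icc.2 (hry.trans hyz)) hx hx.1
  exact H.monotoneOn_sq (convex_Icc r z) hpos h0 ⟨hry, hyz⟩ ⟨hry.trans hyz, le_rfl⟩ hyz

lemma mul_nonpos_of_potential_nonpos (H : IsHermiteSolution s T τ u v) {z : ℝ} (hz : 0 < z)
    (hq : ∀ x ∈ Ici z, hermitePotential s T τ x ≤ 0) {x : ℝ} (hx : z ≤ x) : u x * v x ≤ 0 := by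
  by_contra! hcon
  have hx0 : 0 < x := hz.trans_le hx
  have hpos : ∀ t ∈ Ici x, 0 < t := fun t ht => hx0.trans_le ht
  have hm := H.monotoneOn_mul (convex_Ici x) hpos fun t ht => hq t (hx.trans ht)
  have hsq := H.monotoneOn_sq (convex_Ici x) hpos fun t ht =>
    hcon.le.trans (hm self_mem_Ici ht ht)
  have hux : 0 < u x ^ 2 := by
    have : u x ≠ 0 := fun h => by simp [h] at hcon
    positivity
  set l := 2 / u x ^ 2 with hl
  have hl0 : 0 < l := by positivity
  have hint : ∫ _ in x..x + l, u x ^ 2 ≤ ∫ t in x..x + l, u t ^ 2 :=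
    intervalIntegral.integral_mono_on (by linarith) (by simp)
      (H.intervalIntegrable_sq hx0 (by linarith)) fun t ht => hsq self_mem_Ici ht.1 ht.1
  have := hint.trans (H.mass_le x (x + l) hx0 (by linarith))
  rw [intervalIntegral.integral_const, smul_eq_mul, add_sub_cancel_left, hl,
    div_mul_cancel₀ _ hux.ne'] at this
  linarith

lemma sq_le_of_potential_nonpos (H : IsHermiteSolution s T τ u v) {y z : ℝ} (hz : 0 < z)
    (hzy : z ≤ y) (hq : ∀ x ∈ Ici z, hermitePotential s T τ x ≤ 0) : u y ^ 2 ≤ u z ^ 2 := by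
  have hpos : ∀ x ∈ Ici z, 0 < x := fun x hx => hz.trans_le hx
  refine antitoneOn_of_hasDerivWithinAt_nonpos (convex_Ici z)
    (fun x hx => (H.hasDerivAt_sq (hpos x hx)).continuousAt.continuousWithinAt)
    (fun x hx => (H.hasDerivAt_sq (hpos x (interior_subset hx))).hasDerivWithinAt)
    (fun x hx => ?_) self_mem_Ici hzy hzy
  have := H.mul_nonpos_of_potential_nonpos hz hq (interior_subset hx)
  linarith

lemma twenty_le (H : IsHermiteSolution s T τ u v) {γ : ℝ}
    (hγ : s ^ 2 * γ ^ 6 = 2000 * T ^ 2) : 20 ≤ s * γ ^ 2 := by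
  have hs := H.s_pos
  have h : (20 : ℝ) ^ 3 ≤ (s * γ ^ 2) ^ 3 := by
    have : (s * γ ^ 2) ^ 3 = s * (s ^ 2 * γ ^ 6) := by ring
    rw [this, hγ]
    nlinarith [H.four_le]
  exact le_of_pow_le_pow_left₀ (by norm_num) (by positivity) h

/-- The energy for the multiplier `(T² + γ² - x²)^(-1/2)`. -/
noncomputable def turningEnergy (s T τ γ : ℝ) (u v : ℝ → ℝ) (x : ℝ) : ℝ :=
  (√(T ^ 2 + γ ^ 2 - x ^ 2))⁻¹ * (v x ^ 2 + hermitePotential s T τ x * u x ^ 2)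
    - x / √(T ^ 2 + γ ^ 2 - x ^ 2) ^ 3 * (u x * v x)
    + (1 / √(T ^ 2 + γ ^ 2 - x ^ 2) ^ 3 + 3 * x ^ 2 / √(T ^ 2 + γ ^ 2 - x ^ 2) ^ 5) / 2 * u x ^ 2

lemma hasDerivAt_turningEnergy (H : IsHermiteSolution s T τ u v) {γ x : ℝ} (hx : 0 < x)
    (hg : 0 < T ^ 2 + γ ^ 2 - x ^ 2) :
    HasDerivAt (turningEnergy s T τ γ u v)
      ((2 * (x / √(T ^ 2 + γ ^ 2 - x ^ 2) ^ 3) * hermitePotential s T τ x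
        + (√(T ^ 2 + γ ^ 2 - x ^ 2))⁻¹ * (-2 * s ^ 2 * x + 2 * τ / x ^ 3)
        + (9 * x / √(T ^ 2 + γ ^ 2 - x ^ 2) ^ 5
          + 15 * x ^ 3 / √(T ^ 2 + γ ^ 2 - x ^ 2) ^ 7) / 2) * u x ^ 2) x := by
  have hw0 : 0 < √(T ^ 2 + γ ^ 2 - x ^ 2) := sqrt_pos.2 hg
  have hw : HasDerivAt (fun x => √(T ^ 2 + γ ^ 2 - x ^ 2)) (-x / √(T ^ 2 + γ ^ 2 - x ^ 2)) x := by
    refine (((hasDerivAt_pow 2 x).const_sub (T ^ 2 + γ ^ 2)).sqrt hg.ne').congr_deriv ?_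
    push_cast
    field_simp
  refine H.hasDerivAt_multiplier (f := fun x => (√(T ^ 2 + γ ^ 2 - x ^ 2))⁻¹)
    (f₁ := fun x => x / √(T ^ 2 + γ ^ 2 - x ^ 2) ^ 3)
    (f₂ := fun x => 1 / √(T ^ 2 + γ ^ 2 - x ^ 2) ^ 3 + 3 * x ^ 2 / √(T ^ 2 + γ ^ 2 - x ^ 2) ^ 5)
    hx ?_ ?_ ?_
  · refine (hw.fun_inv hw0.ne').congr_deriv ?_
    field_simp
  · refine ((hasDerivAt_id' x).fun_div (hw.fun_pow 3) (by positivity)).congr_deriv ?_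
    push_cast
    field_simp
    ring
  · refine (((hasDerivAt_const x (1 : ℝ)).fun_div (hw.fun_pow 3) (by positivity)).fun_add
      (((hasDerivAt_pow 2 x).const_mul 3).fun_div (hw.fun_pow 5) (by positivity))).congr_deriv ?_
    push_cast
    field_simp
    ring

lemma turningEnergy_deriv_nonpos (H : IsHermiteSolution s T τ u v) {γ x : ℝ} (hγ0 : 0 < γ)
    (hγ : s ^ 2 * γ ^ 6 = 2000 * T ^ 2) (hx : T / 2 ≤ x) (hxT : x ≤ T) :
    2 * (x / √(T ^ 2 + γ ^ 2 - x ^ 2) ^ 3) * hermitePotential s T τ x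
        + (√(T ^ 2 + γ ^ 2 - x ^ 2))⁻¹ * (-2 * s ^ 2 * x + 2 * τ / x ^ 3)
        + (9 * x / √(T ^ 2 + γ ^ 2 - x ^ 2) ^ 5
          + 15 * x ^ 3 / √(T ^ 2 + γ ^ 2 - x ^ 2) ^ 7) / 2 ≤ 0 := by
  have hs := H.s_pos
  have hT := H.T_pos
  have hτ := H.tau_nonneg
  have hx0 : 0 < x := by linarith
  have hx2 : x ^ 2 ≤ T ^ 2 := by gcongr
  have hx2' : T ^ 2 / 4 ≤ x ^ 2 := by
    calc T ^ 2 / 4 = (T / 2) ^ 2 := by ring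
      _ ≤ x ^ 2 := by gcongr
  have hg0 : 0 < T ^ 2 + γ ^ 2 - x ^ 2 := by nlinarith
  have hgγ : γ ^ 2 ≤ T ^ 2 + γ ^ 2 - x ^ 2 := by linarith
  set w := √(T ^ 2 + γ ^ 2 - x ^ 2) with hw
  have hw0 : 0 < w := sqrt_pos.2 hg0
  have hw2 : w ^ 2 = T ^ 2 + γ ^ 2 - x ^ 2 := sq_sqrt hg0.le
  have h20 := H.twenty_le hγ
  have key : 2 * (x / w ^ 3) * hermitePotential s T τ x
        + w⁻¹ * (-2 * s ^ 2 * x + 2 * τ / x ^ 3) + (9 * x / w ^ 5 + 15 * x ^ 3 / w ^ 7) / 2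
      = x / w ^ 3 * (-2 * s ^ 2 * γ ^ 2 + 2 * τ * (T ^ 2 + γ ^ 2) / x ^ 4 - 4 * τ / x ^ 2
        + 9 / 2 / w ^ 2 + 15 / 2 * (x ^ 2 / w ^ 4)) := by
    have hγ2 : γ ^ 2 = w ^ 2 + x ^ 2 - T ^ 2 := by rw [hw2]; ring
    rw [hγ2]
    unfold hermitePotential
    field_simp
    ring
  rw [key]
  refine mul_nonpos_of_nonneg_of_nonpos (by positivity) ?_
  have e0 : 0 ≤ 4 * τ / x ^ 2 := by positivity
  have e1 : 9 / 2 / w ^ 2 ≤ s := by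
    rw [div_le_iff₀ (by positivity), hw2]
    nlinarith
  have e2 : 15 / 2 * (x ^ 2 / w ^ 4) ≤ s ^ 2 * γ ^ 2 / 200 := by
    have : x ^ 2 / w ^ 4 ≤ T ^ 2 / γ ^ 4 := by
      have : γ ^ 4 ≤ w ^ 4 := by
        rw [show γ ^ 4 = (γ ^ 2) ^ 2 by ring, show w ^ 4 = (w ^ 2) ^ 2 by ring, hw2]
        gcongr
      gcongr
    have h3 : T ^ 2 / γ ^ 4 = s ^ 2 * γ ^ 2 / 2000 := by
      rw [div_eq_iff (by positivity)]; linarith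
    nlinarith [mul_pos (pow_pos hs 2) (pow_pos hγ0 2)]
  have e3 : 2 * τ * (T ^ 2 + γ ^ 2) / x ^ 4 ≤ 6 * s + 3 / 2 * (s ^ 2 * γ ^ 2) := by
    have hx4 : T ^ 4 / 16 ≤ x ^ 4 := by
      calc T ^ 4 / 16 = (T ^ 2 / 4) ^ 2 := by ring
        _ ≤ (x ^ 2) ^ 2 := by gcongr
        _ = x ^ 4 := by ring
    rw [div_le_iff₀ (by positivity)]
    have a1 : 2 * τ * (T ^ 2 + γ ^ 2) ≤ 3 / 2 * (T ^ 2 + γ ^ 2) := by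
      gcongr; linarith [H.tau_le]
    have a2 : (6 * s + 3 / 2 * (s ^ 2 * γ ^ 2)) * (T ^ 4 / 16)
        ≤ (6 * s + 3 / 2 * (s ^ 2 * γ ^ 2)) * x ^ 4 := by gcongr
    have a3 := mul_le_mul_of_nonneg_right H.four_le (sq_nonneg T)
    have a4 := mul_le_mul_of_nonneg_right H.sixteen_le (sq_nonneg γ)
    nlinarith
  nlinarith

lemma turningEnergy_le_left (H : IsHermiteSolution s T τ u v) {γ x : ℝ} (hγ0 : 0 < γ)
    (hγ : s ^ 2 * γ ^ 6 = 2000 * T ^ 2) (hx : T / 2 ≤ x) (hxT : x ≤ T) :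
    turningEnergy s T τ γ u v x ≤ turningEnergy s T τ γ u v (T / 2) := by
  have hT := H.T_pos
  have hpos : ∀ y ∈ Icc (T / 2) T, 0 < y := fun y hy => by linarith [hy.1]
  have hg : ∀ y ∈ Icc (T / 2) T, 0 < T ^ 2 + γ ^ 2 - y ^ 2 := fun y hy => by
    nlinarith [pow_pos hγ0 2, hy.1, hy.2]
  refine antitoneOn_of_hasDerivWithinAt_nonpos (convex_Icc (T / 2) T)
    (fun y hy => (H.hasDerivAt_turningEnergy (hpos y hy) (hg y hy)).continuousAt.continuousWithinAt)
    (fun y hy => (H.hasDerivAt_turningEnergy (hpos y (interior_subset hy))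
      (hg y (interior_subset hy))).hasDerivWithinAt)
    (fun y hy => ?_) ⟨le_rfl, by linarith⟩ ⟨hx, hxT⟩ hx
  have hy' := interior_subset hy
  exact mul_nonpos_of_nonpos_of_nonneg (H.turningEnergy_deriv_nonpos hγ0 hγ hy'.1 hy'.2)
    (sq_nonneg _)

lemma turningEnergy_half_le (H : IsHermiteSolution s T τ u v) {γ : ℝ} (hγ0 : 0 < γ) :
    turningEnergy s T τ γ u v (T / 2) ≤ 924 * s ^ 2 := by
  have hs := H.s_pos
  have hT := H.T_pos
  have hE := H.energy_le (half_pos hT) le_rfl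
  have hq := H.quarter_le_potential le_rfl H.inner_le (half_pos hT)
  have hg0 : 0 < T ^ 2 + γ ^ 2 - (T / 2) ^ 2 := by nlinarith [pow_pos hγ0 2]
  unfold turningEnergy
  set w := √(T ^ 2 + γ ^ 2 - (T / 2) ^ 2) with hw
  have hw0 : 0 < w := sqrt_pos.2 hg0
  have hw2 : w ^ 2 = T ^ 2 + γ ^ 2 - (T / 2) ^ 2 := sq_sqrt hg0.le
  have hwT : 3 * (T / 2) ^ 2 ≤ w ^ 2 := by rw [hw2]; nlinarith [pow_pos hγ0 2]
  have hwT' : T / 2 ≤ w := by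
    refine le_of_pow_le_pow_left₀ two_ne_zero hw0.le ?_
    nlinarith [sq_nonneg (T / 2)]
  set y := T / 2 with hy
  have hy0 : 0 < y := half_pos hT
  set q := hermitePotential s T τ y
  set a := v y
  set b := u y
  have hqy : s ^ 2 * y ^ 2 ≤ q := by rw [hy]; linarith
  have hsy : 1 ≤ s ^ 2 * y ^ 4 := by rw [hy]; nlinarith [H.sixteen_le]
  have hsyw : 3 ≤ q * w ^ 2 := by
    calc (3 : ℝ) ≤ (s ^ 2 * y ^ 2) * (3 * y ^ 2) := by nlinarith
      _ ≤ q * w ^ 2 := by gcongr; exact le_trans (by positivity) hqy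
  have hq0 : 0 < q := lt_of_lt_of_le (by positivity) hqy
  -- all terms are compared with `w⁻¹` times the energy
  have key : w⁻¹ * (a ^ 2 + q * b ^ 2) - y / w ^ 3 * (b * a)
      + (1 / w ^ 3 + 3 * y ^ 2 / w ^ 5) / 2 * b ^ 2 ≤ w⁻¹ * (7 * (a ^ 2 / 4 + q * b ^ 2)) := by
    have id : w⁻¹ * (a ^ 2 + q * b ^ 2) - y / w ^ 3 * (b * a)
      + (1 / w ^ 3 + 3 * y ^ 2 / w ^ 5) / 2 * b ^ 2 = w⁻¹ * (a ^ 2 + q * b ^ 2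
        - (y / w ^ 2 * b) * a + (1 + 3 * (y ^ 2 / w ^ 2)) / 2 * (b ^ 2 / w ^ 2)) := by
      field_simp
    rw [id]
    refine mul_le_mul_of_nonneg_left ?_ (by positivity)
    have r1 : y ^ 2 / w ^ 2 ≤ 1 / 3 := by
      rw [div_le_iff₀ (by positivity)]; linarith
    have r2 : b ^ 2 / w ^ 2 ≤ q * b ^ 2 / 3 := by
      rw [div_le_iff₀ (by positivity)]
      nlinarith [mul_le_mul_of_nonneg_right hsyw (sq_nonneg b)]
    have r3 : (y / w ^ 2 * b) ^ 2 = y ^ 2 / w ^ 2 * (b ^ 2 / w ^ 2) := by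
      field_simp
    have r4 : (0 : ℝ) ≤ b ^ 2 / w ^ 2 := by positivity
    have r5 := mul_le_mul_of_nonneg_right r1 r4
    nlinarith [sq_nonneg (y / w ^ 2 * b + a), mul_nonneg hq0.le (sq_nonneg b), sq_nonneg a]
  refine key.trans ?_
  calc w⁻¹ * (7 * (a ^ 2 / 4 + q * b ^ 2)) ≤ y⁻¹ * (7 * (66 * s ^ 2 * T)) := by
        gcongr
    _ = 924 * s ^ 2 := by rw [hy]; field_simp; norm_num

lemma le_turningEnergy (H : IsHermiteSolution s T τ u v) {γ x : ℝ} (hγ0 : 0 < γ)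
    (hγ : s ^ 2 * γ ^ 6 = 2000 * T ^ 2) (hx : T / 2 ≤ x) (hxT : x ≤ T)
    (hq : 0 ≤ hermitePotential s T τ x) :
    s ^ 2 * γ / 50000 * u x ^ 2 ≤ turningEnergy s T τ γ u v x := by
  have hs := H.s_pos
  have hT := H.T_pos
  have hx0 : 0 < x := by linarith
  have hx2 : x ^ 2 ≤ T ^ 2 := by gcongr
  have hx2' : T ^ 2 / 4 ≤ x ^ 2 := by
    calc T ^ 2 / 4 = (T / 2) ^ 2 := by ring
      _ ≤ x ^ 2 := by gcongr
  have hg0 : 0 < T ^ 2 + γ ^ 2 - x ^ 2 := by nlinarith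
  unfold turningEnergy
  set w := √(T ^ 2 + γ ^ 2 - x ^ 2) with hw
  have hw0 : 0 < w := sqrt_pos.2 hg0
  have hw2 : w ^ 2 = T ^ 2 + γ ^ 2 - x ^ 2 := sq_sqrt hg0.le
  have hwγ : γ ≤ w := by
    refine le_of_pow_le_pow_left₀ two_ne_zero hw0.le ?_
    rw [hw2]; linarith
  set q := hermitePotential s T τ x with hqdef
  set a := v x
  set b := u x
  have hlow : w⁻¹ * (q + 5 / 4 * (x ^ 2 / w ^ 4)) * b ^ 2 ≤ w⁻¹ * (a ^ 2 + q * b ^ 2)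
      - x / w ^ 3 * (b * a) + (1 / w ^ 3 + 3 * x ^ 2 / w ^ 5) / 2 * b ^ 2 := by
    have id : w⁻¹ * (a ^ 2 + q * b ^ 2) - x / w ^ 3 * (b * a)
        + (1 / w ^ 3 + 3 * x ^ 2 / w ^ 5) / 2 * b ^ 2
        - w⁻¹ * (q + 5 / 4 * (x ^ 2 / w ^ 4)) * b ^ 2
        = w⁻¹ * (a - x * b / (2 * w ^ 2)) ^ 2 + b ^ 2 / (2 * w ^ 3) := by
      field_simp
      ring
    have : 0 ≤ w⁻¹ * (a - x * b / (2 * w ^ 2)) ^ 2 + b ^ 2 / (2 * w ^ 3) := by positivity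
    linarith
  refine le_trans (mul_le_mul_of_nonneg_right ?_ (sq_nonneg b)) hlow
  rcases le_total (w ^ 2) (2 * γ ^ 2) with h | h
  · have hw' : w ≤ 3 / 2 * γ := by
      refine le_of_pow_le_pow_left₀ two_ne_zero (by positivity) ?_
      nlinarith [pow_pos hγ0 2]
    have h5 : w ^ 5 ≤ (3 / 2 * γ) ^ 5 := by gcongr
    calc s ^ 2 * γ / 50000 ≤ 5 / 4 * (T ^ 2 / 4) / (3 / 2 * γ) ^ 5 := by
          rw [le_div_iff₀ (by positivity)]
          have : s ^ 2 * γ / 50000 * (3 / 2 * γ) ^ 5 = 243 / 32 / 50000 * (s ^ 2 * γ ^ 6) := by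
            ring
          rw [this, hγ]
          nlinarith [pow_pos hT 2]
      _ ≤ 5 / 4 * x ^ 2 / w ^ 5 := by gcongr
      _ = w⁻¹ * (0 + 5 / 4 * (x ^ 2 / w ^ 4)) := by field_simp; ring
      _ ≤ w⁻¹ * (q + 5 / 4 * (x ^ 2 / w ^ 4)) := by gcongr
  · have hτx : τ / x ^ 2 ≤ 3 / 4 * s := by
      rw [div_le_iff₀ (by positivity)]
      nlinarith [H.tau_le, H.four_le]
    have h20 := H.twenty_le hγ
    have hqw : s ^ 2 * w ^ 2 / 50000 ≤ q := by
      have : q = s ^ 2 * (w ^ 2 - γ ^ 2) - τ / x ^ 2 := by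
        rw [hw2, hqdef]; unfold hermitePotential; ring
      rw [this]
      have e1 := mul_le_mul_of_nonneg_left h (sq_nonneg s)
      have e2 := mul_le_mul_of_nonneg_left h20 hs.le
      nlinarith
    calc s ^ 2 * γ / 50000 ≤ s ^ 2 * w / 50000 := by gcongr
      _ = w⁻¹ * (s ^ 2 * w ^ 2 / 50000 + 0) := by field_simp; ring
      _ ≤ w⁻¹ * (q + 5 / 4 * (x ^ 2 / w ^ 4)) := by gcongr; positivity

lemma mul_sq_le_of_turning (H : IsHermiteSolution s T τ u v) {γ x : ℝ} (hγ0 : 0 < γ)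
    (hγ : s ^ 2 * γ ^ 6 = 2000 * T ^ 2) (hx : T / 2 ≤ x) (hq : 0 ≤ hermitePotential s T τ x) :
    γ * u x ^ 2 ≤ 50000000 := by
  have hs := H.s_pos
  have hT := H.T_pos
  have hxT : x ≤ T := by
    have : 0 ≤ τ / x ^ 2 := div_nonneg H.tau_nonneg (sq_nonneg x)
    have : 0 ≤ s ^ 2 * (T ^ 2 - x ^ 2) := by unfold hermitePotential at hq; linarith
    have := nonneg_of_mul_nonneg_right this (pow_pos hs 2)
    exact le_of_pow_le_pow_left₀ two_ne_zero hT.le (by linarith)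
  have h := (H.le_turningEnergy hγ0 hγ hx hxT hq).trans
    ((H.turningEnergy_le_left hγ0 hγ hx hxT).trans (H.turningEnergy_half_le hγ0))
  have : s ^ 2 * (γ * u x ^ 2) ≤ s ^ 2 * 50000000 := by nlinarith [pow_pos hs 2]
  exact le_of_mul_le_mul_left this (by positivity)

theorem mul_sq_le (H : IsHermiteSolution s T τ u v) {γ r x : ℝ} (hγ0 : 0 < γ)
    (hγ : s ^ 2 * γ ^ 6 = 2000 * T ^ 2) (hr : 0 < r) (hur : u r = 0) (hx : r ≤ x) :
    γ * u x ^ 2 ≤ 50000000 := by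
  have hs := H.s_pos
  have hT := H.T_pos
  have hx0 : 0 < x := hr.trans_le hx
  have hqT : 0 < hermitePotential s T τ (T / 2) :=
    lt_of_lt_of_le (by positivity) (H.quarter_le_potential le_rfl H.inner_le (half_pos hT))
  have hγT : γ ≤ 3 * T := by
    have h20 := H.twenty_le hγ
    refine le_of_pow_le_pow_left₀ two_ne_zero (by positivity) ?_
    have h1 : 400 * γ ^ 2 ≤ 2000 * T ^ 2 := by
      rw [← hγ]
      calc 400 * γ ^ 2 = 20 ^ 2 * γ ^ 2 := by ring
        _ ≤ (s * γ ^ 2) ^ 2 * γ ^ 2 := by gcongr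
        _ = s ^ 2 * γ ^ 6 := by ring
    nlinarith
  have small : ∀ z, u z ^ 2 ≤ 1320 / T → γ * u z ^ 2 ≤ 50000000 := fun z hz => by
    calc γ * u z ^ 2 ≤ 3 * T * (1320 / T) := by gcongr
      _ = 3960 := by field_simp; norm_num
      _ ≤ 50000000 := by norm_num
  have mono : ∀ z, u x ^ 2 ≤ u z ^ 2 → γ * u z ^ 2 ≤ 50000000 → γ * u x ^ 2 ≤ 50000000 :=
    fun z hz h => (mul_le_mul_of_nonneg_left hz hγ0.le).trans h
  rcases le_total (T / 2) x with hxT | hxT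
  · rcases le_or_gt 0 (hermitePotential s T τ x) with hq | hq
    · exact H.mul_sq_le_of_turning hγ0 hγ hxT hq
    · obtain ⟨z, hz, hqz⟩ := intermediate_value_Icc' hxT
        ((continuousOn_potential s T τ).mono fun t ht => (half_pos hT).trans_le ht.1)
        ⟨hq.le, hqT.le⟩
      have hz0 : 0 < z := (half_pos hT).trans_le hz.1
      refine mono z (H.sq_le_of_potential_nonpos hz0 hz.2 fun t ht => ?_)
        (H.mul_sq_le_of_turning hγ0 hγ hz.1 hqz.ge)
      by_contra! hcon
      exact (potential_pos_of_mem (half_pos hT) hz.1 ht hqT hcon).ne' hqz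
  · rcases le_total (√(2 * τ) / (s * T)) x with hy | hy
    · exact small x ((H.sq_le_of_bulk hxT hy hx0).trans (by gcongr; norm_num))
    set y₁ := √(2 * τ) / (s * T) with hy₁
    have hy₁0 : 0 < y₁ := hx0.trans_le hy
    have hq₁ : 0 < hermitePotential s T τ y₁ :=
      lt_of_lt_of_le (by positivity) (H.quarter_le_potential H.inner_le le_rfl hy₁0)
    rcases le_or_gt 0 (hermitePotential s T τ x) with hq | hq
    · exact small x (H.sq_le_of_inner hx0 hy hq)
    · obtain ⟨z, hz, hqz⟩ := intermediate_value_Icc hy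
        ((continuousOn_potential s T τ).mono fun t ht => hx0.trans_le ht.1) ⟨hq.le, hq₁.le⟩
      refine mono z (H.sq_le_of_zero hr hur hx hz.1 fun t ht => ?_)
        (small z (H.sq_le_of_inner (hx0.trans_le hz.1) hz.2 hqz.ge))
      by_contra! hcon
      exact (potential_pos_of_mem (hr.trans_le ht.1) ht.2 hz.2 hcon hq₁).ne' hqz

end IsHermiteSolution

/-- If `p` is orthonormal for the functional `Φ` and `F` of degree `k` is orthogonal to all lower
powers, then `p k` is a multiple of `F`. -/
theorem exists_eq_C_mul_of_orthogonal (Φ : Polynomial ℝ →ₗ[ℝ] ℝ) (p : ℕ → Polynomial ℝ)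
    (hdeg : ∀ k, (p k).degree = k) (horth : ∀ k l, Φ (p k * p l) = if k = l then 1 else 0)
    (k : ℕ) (F : Polynomial ℝ) (hF : F.degree = k)
    (hFΦ : ∀ j < k, Φ (F * Polynomial.X ^ j) = 0) : ∃ a, p k = Polynomial.C a * F := by
  have hp0 : ∀ k, p k ≠ 0 := fun k h => by simpa [h] using hdeg k
  have hsplit : ∀ r : Polynomial ℝ, r ≠ 0 → ∃ a ≠ 0, ∃ r' : Polynomial ℝ,
      r = Polynomial.C a * p r.natDegree + r' ∧ r'.degree < r.degree := by
    intro r hr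
    have hlc : (p r.natDegree).leadingCoeff ≠ 0 := Polynomial.leadingCoeff_ne_zero.2 (hp0 _)
    have ha : r.leadingCoeff / (p r.natDegree).leadingCoeff ≠ 0 :=
      div_ne_zero (Polynomial.leadingCoeff_ne_zero.2 hr) hlc
    refine ⟨_, ha, r - Polynomial.C (r.leadingCoeff / (p r.natDegree).leadingCoeff) *
      p r.natDegree, by ring, ?_⟩
    refine Polynomial.degree_sub_lt_left ?_ hr ?_
    · rw [Polynomial.degree_C_mul ha, hdeg, Polynomial.degree_eq_natDegree hr]
    · rw [Polynomial.leadingCoeff_mul, Polynomial.leadingCoeff_C, div_mul_cancel₀ _ hlc]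
  have hsmul : ∀ (a : ℝ) (q r : Polynomial ℝ), Φ (q * (Polynomial.C a * r)) = a * Φ (q * r) := by
    intro a q r
    rw [← smul_eq_mul a, ← map_smul, Polynomial.smul_eq_C_mul]
    congr 1
    ring
  have hlow : ∀ k n : ℕ, ∀ r : Polynomial ℝ, r.natDegree < n → r.degree < k →
      Φ (p k * r) = 0 := by
    intro k n
    induction n with
    | zero => intro r hr; omega
    | succ n ih =>
      intro r hrn hrk
      by_cases hr : r = 0
      · simp [hr]
      obtain ⟨a, -, r', hr', hd⟩ := hsplit r hr
      have hk : r.natDegree < k := (Polynomial.natDegree_lt_iff_degree_lt hr).2 hrk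
      have hr0 : Φ (p k * r') = 0 := by
        by_cases h0 : r' = 0
        · simp [h0]
        · exact ih r' ((Polynomial.natDegree_lt_natDegree h0 hd).trans_le (by omega))
            (hd.trans hrk)
      rw [hr', mul_add, map_add, hsmul, horth, if_neg hk.ne', hr0]
      simp
  have hFlow : ∀ r : Polynomial ℝ, r.degree < k → Φ (F * r) = 0 := by
    intro r hr
    by_cases h : r = 0
    · simp [h]
    rw [r.as_sum_range_C_mul_X_pow' ((Polynomial.natDegree_lt_iff_degree_lt h).2 hr),
      Finset.mul_sum, map_sum]
    refine Finset.sum_eq_zero fun j hj => ?_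
    rw [hsmul, hFΦ j (Finset.mem_range.1 hj), mul_zero]
  have hF0 : F ≠ 0 := fun h => by simp [h] at hF
  have hFl : F.leadingCoeff ≠ 0 := Polynomial.leadingCoeff_ne_zero.2 hF0
  set a := (p k).leadingCoeff / F.leadingCoeff with ha
  have ha0 : a ≠ 0 := div_ne_zero (Polynomial.leadingCoeff_ne_zero.2 (hp0 k)) hFl
  refine ⟨a, sub_eq_zero.1 ?_⟩
  by_contra hq
  set q := p k - Polynomial.C a * F with hqdef
  have hqd : q.degree < k := by
    rw [← hdeg k]
    refine Polynomial.degree_sub_lt_left ?_ (hp0 k) ?_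
    · rw [Polynomial.degree_C_mul ha0, hdeg, hF]
    · rw [Polynomial.leadingCoeff_mul, Polynomial.leadingCoeff_C, ha, div_mul_cancel₀ _ hFl]
  obtain ⟨b, hb, r', hr', hd⟩ := hsplit q hq
  set d := q.natDegree with hddef
  have hdk : d < k := (Polynomial.natDegree_lt_iff_degree_lt hq).2 hqd
  have e1 : Φ (p d * q) = 0 := by
    have hdd : (p d).degree < k := by rw [hdeg]; exact_mod_cast hdk
    have : p d * q = p k * p d - F * (Polynomial.C a * p d) := by rw [hqdef]; ring
    rw [this, map_sub, hsmul, horth, if_neg hdk.ne', hFlow _ hdd]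
    simp
  have e2 : Φ (p d * r') = 0 :=
    hlow d (r'.natDegree + 1) r' (by omega) (by rwa [Polynomial.degree_eq_natDegree hq] at hd)
  rw [hr', mul_add, map_add, hsmul, horth, if_pos rfl, e2] at e1
  simp at e1
  exact hb e1

/-- Coefficients of the even polynomial solution of degree `2 * n` of the generalized Hermite
equation. -/
noncomputable def evenHermiteCoeff (σ s : ℝ) (n : ℕ) : ℕ → ℝ
  | 0 => 1
  | j + 1 => -(4 * s * (n - j)) / ((j + 1) * (4 * j + 2 + 4 * σ)) * evenHermiteCoeff σ s n j

/-- The even polynomial solution of degree `2 * n` of the generalized Hermite equation. -/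
noncomputable def evenHermite (σ s : ℝ) (n : ℕ) : Polynomial ℝ :=
  ∑ j ∈ Finset.range (n + 1), Polynomial.C (evenHermiteCoeff σ s n j) * Polynomial.X ^ (2 * j)

section
variable {σ s : ℝ} (n : ℕ)

lemma evenHermiteCoeff_succ (hσ : -(1/2) < σ) (j : ℕ) :
    (j + 1) * (4 * j + 2 + 4 * σ) * evenHermiteCoeff σ s n (j + 1) =
      -(4 * s * (n - j)) * evenHermiteCoeff σ s n j := by
  have : (0 : ℝ) < 4 * j + 2 + 4 * σ := by
    have : (0 : ℝ) ≤ j := j.cast_nonneg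
    linarith
  rw [evenHermiteCoeff]
  generalize 4 * (j : ℝ) + 2 + 4 * σ = D at *
  field_simp

lemma evenHermiteCoeff_ne_zero (hσ : -(1/2) < σ) (hs : 0 < s) {j : ℕ} (hj : j ≤ n) :
    evenHermiteCoeff σ s n j ≠ 0 := by
  induction j with
  | zero => simp [evenHermiteCoeff]
  | succ j ih =>
    intro h
    have key := evenHermiteCoeff_succ (s := s) n hσ j
    have hjn : (0 : ℝ) < n - j := sub_pos.2 (by exact_mod_cast hj)
    rw [h, mul_zero, eq_comm, mul_eq_zero, neg_eq_zero] at key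
    rcases key with key | key
    · exact absurd key (by positivity)
    · exact ih (by omega) key

lemma degree_evenHermite (hσ : -(1/2) < σ) (hs : 0 < s) :
    (evenHermite σ s n).degree = (2 * n : ℕ) := by
  have hc := evenHermiteCoeff_ne_zero n hσ hs le_rfl
  rw [evenHermite, Finset.sum_range_succ, Polynomial.degree_add_eq_right_of_degree_lt,
    Polynomial.degree_C_mul_X_pow _ hc]
  rw [Polynomial.degree_C_mul_X_pow _ hc]
  refine (Polynomial.degree_sum_le _ _).trans_lt ?_
  rw [Finset.sup_lt_iff (by exact WithBot.bot_lt_coe _)]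
  intro j hj
  refine (Polynomial.degree_C_mul_X_pow_le _ _).trans_lt ?_
  have := Finset.mem_range.1 hj
  exact_mod_cast (by omega : 2 * j < 2 * n)

lemma evenHermite_ode (hσ : -(1/2) < σ) (x : ℝ) :
    x * (evenHermite σ s n).derivative.derivative.eval x
      + 2 * (σ - s * x ^ 2) * (evenHermite σ s n).derivative.eval x
      + 4 * n * s * x * (evenHermite σ s n).eval x = 0 := by
  have key : ∀ m : ℕ, ∀ G : Polynomial ℝ,
      G = ∑ j ∈ Finset.range (m + 1),
        Polynomial.C (evenHermiteCoeff σ s n j) * Polynomial.X ^ (2 * j) →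
      x * G.derivative.derivative.eval x + 2 * (σ - s * x ^ 2) * G.derivative.eval x
        + 4 * n * s * x * G.eval x
      = 4 * s * (n - m) * evenHermiteCoeff σ s n m * x ^ (2 * m + 1) := by
    intro m
    induction m with
    | zero =>
      rintro G rfl
      simp
      ring
    | succ m ih =>
      rintro G rfl
      have h := ih _ rfl
      rw [Finset.sum_range_succ]
      set G := ∑ j ∈ Finset.range (m + 1),
        Polynomial.C (evenHermiteCoeff σ s n j) * Polynomial.X ^ (2 * j)
      have hc := evenHermiteCoeff_succ (s := s) n hσ m
      rw [show 2 * (m + 1) = 2 * m + 1 + 1 by ring]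
      simp only [Polynomial.derivative_add, Polynomial.eval_add, Polynomial.derivative_C_mul,
        Polynomial.derivative_X_pow, Polynomial.eval_mul, Polynomial.eval_C, Polynomial.eval_pow,
        Polynomial.eval_X, Nat.add_sub_cancel]
      push_cast
      linear_combination h + x ^ (2 * m + 1) * hc
  have := key n _ rfl
  rw [evenHermite, this]
  ring

/-- Sums of the coefficients against a sequence with the moment recurrence vanish. -/
lemma sum_evenHermiteCoeff_mul_eq_zero (hσ : -(1/2) < σ) (hs : 0 < s) {μ : ℕ → ℝ}
    (hμ : ∀ j : ℕ, 2 * s * μ (j + 1) = (2 * j + 1 + 2 * σ) * μ j) {i : ℕ} (hi : i < n) :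
    ∑ j ∈ Finset.range (n + 1), evenHermiteCoeff σ s n j * μ (i + j) = 0 := by
  induction i with
  | zero =>
    have key : ∀ m : ℕ, n * ∑ j ∈ Finset.range (m + 1), evenHermiteCoeff σ s n j * μ (0 + j) =
        (n - m) * evenHermiteCoeff σ s n m * μ m := by
      intro m
      induction m with
      | zero => simp; ring
      | succ m ih =>
        rw [Finset.sum_range_succ, mul_add, ih, zero_add]
        have hc := evenHermiteCoeff_succ (s := s) n hσ m
        have hm := hμ m
        push_cast
        have : (2 * s) * ((n - m) * evenHermiteCoeff σ s n m * μ m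
          + (m + 1) * (evenHermiteCoeff σ s n (m + 1) * μ (m + 1))) = 0 := by
          linear_combination (m + 1) * evenHermiteCoeff σ s n (m + 1) * hm + μ m / 2 * hc
        have := (mul_eq_zero.1 this).resolve_left (by positivity)
        linear_combination this
    have := key n
    rw [sub_self, zero_mul, zero_mul, mul_eq_zero] at this
    exact this.resolve_left (by exact_mod_cast hi.ne')
  | succ i ih =>
    have key : ∀ m : ℕ, 4 * s * (i + 1 - n) *
        ∑ j ∈ Finset.range (m + 1), evenHermiteCoeff σ s n j * μ (i + 1 + j)
        - (2 * i + 2) * (2 * i + 1 + 2 * σ) *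
          ∑ j ∈ Finset.range (m + 1), evenHermiteCoeff σ s n j * μ (i + j)
        = -(4 * s * (n - m)) * evenHermiteCoeff σ s n m * μ (i + m + 1) := by
      intro m
      induction m with
      | zero =>
        have hm := hμ i
        simp [evenHermiteCoeff]
        linear_combination (2 * i + 2) * hm
      | succ m ih =>
        rw [Finset.sum_range_succ, Finset.sum_range_succ _ (m + 1), mul_add, mul_add]
        have hc := evenHermiteCoeff_succ (s := s) n hσ m
        have hm := hμ (i + m + 1)
        rw [show i + 1 + (m + 1) = i + m + 1 + 1 by ring, show i + (m + 1) = i + m + 1 by ring]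
        push_cast at hm ⊢
        linear_combination ih - μ (i + m + 1) * hc + 2 * (i - m) *
          evenHermiteCoeff σ s n (m + 1) * hm
    have h := key n
    rw [ih (by omega), sub_self, mul_zero, mul_zero, neg_zero, zero_mul, zero_mul, sub_zero,
      mul_eq_zero] at h
    refine h.resolve_left (mul_ne_zero (by positivity) ?_)
    have : ((i + 1 : ℕ) : ℝ) < n := by exact_mod_cast hi
    push_cast at this
    linarith

end

section
variable {σ s : ℝ}

lemma integrable_pow_mul_weight (hσ : -(1/2) < σ) (hs : 0 < s) (n : ℕ) :
    Integrable fun x : ℝ => x ^ n * (|x| ^ (2 * σ) * exp (-s * x ^ 2)) := by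
  have h0 : (0 : ℝ) ≤ n := n.cast_nonneg
  have hp : IntegrableOn (fun x : ℝ => x ^ n * (|x| ^ (2 * σ) * exp (-s * x ^ 2))) (Ioi 0) := by
    refine (integrableOn_rpow_mul_exp_neg_mul_sq hs (s := n + 2 * σ) (by linarith)).congr_fun
      (fun x hx => ?_) measurableSet_Ioi
    have hx0 : 0 < x := hx
    simp only [abs_of_pos hx0, rpow_add hx0, rpow_natCast]
    ring
  rw [← integrableOn_univ, ← Iio_union_Ici (a := (0 : ℝ)), integrableOn_union,
    integrableOn_Ici_iff_integrableOn_Ioi]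
  refine ⟨?_, hp⟩
  rw [← (Measure.measurePreserving_neg (volume : Measure ℝ)).integrableOn_comp_preimage
    (Homeomorph.neg ℝ).measurableEmbedding]
  simp only [Function.comp_def, neg_sq, neg_preimage, neg_Iio, neg_zero, abs_neg]
  refine IntegrableOn.congr_fun (hp.const_mul ((-1) ^ n)) (fun x _ => ?_) measurableSet_Ioi
  simp only [neg_pow x n, mul_assoc]

lemma integrable_eval_mul_weight (hσ : -(1/2) < σ) (hs : 0 < s) (q : Polynomial ℝ) :
    Integrable fun x : ℝ => q.eval x * (|x| ^ (2 * σ) * exp (-s * x ^ 2)) := by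
  simp only [Polynomial.eval_eq_sum, Polynomial.sum, Finset.sum_mul, mul_assoc]
  exact integrable_finsetSum _ fun n _ => (integrable_pow_mul_weight hσ hs n).const_mul _

/-- Integration of polynomials against the weight `|x| ^ (2 * σ) * exp (-s * x ^ 2)`. -/
noncomputable def weightIntegral (hσ : -(1/2) < σ) (hs : 0 < s) : Polynomial ℝ →ₗ[ℝ] ℝ where
  toFun q := ∫ x : ℝ, q.eval x * (|x| ^ (2 * σ) * exp (-s * x ^ 2))
  map_add' q r := by
    simp only [Polynomial.eval_add, add_mul]
    exact integral_add (integrable_eval_mul_weight hσ hs q) (integrable_eval_mul_weight hσ hs r)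
  map_smul' a q := by
    simp [mul_assoc, integral_const_mul]

lemma weightIntegral_apply (hσ : -(1/2) < σ) (hs : 0 < s) (q : Polynomial ℝ) :
    weightIntegral hσ hs q = ∫ x : ℝ, q.eval x * (|x| ^ (2 * σ) * exp (-s * x ^ 2)) := rfl

lemma weightIntegral_X_pow_odd (hσ : -(1/2) < σ) (hs : 0 < s) {n : ℕ} (hn : Odd n) :
    weightIntegral hσ hs (Polynomial.X ^ n) = 0 := by
  have h := integral_neg_eq_self
    (fun x : ℝ => x ^ n * (|x| ^ (2 * σ) * exp (-s * x ^ 2))) volume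
  simp only [hn.neg_pow, abs_neg, neg_sq, neg_mul, integral_neg] at h
  simp only [weightIntegral_apply, Polynomial.eval_pow, Polynomial.eval_X, neg_mul]
  linarith

lemma weightIntegral_X_pow_even (hσ : -(1/2) < σ) (hs : 0 < s) (j : ℕ) :
    weightIntegral hσ hs (Polynomial.X ^ (2 * j)) =
      s ^ (-(j + σ + 1 / 2)) * Gamma (j + σ + 1 / 2) := by
  have h0 : (0 : ℝ) ≤ j := j.cast_nonneg
  have h := integral_rpow_mul_exp_neg_mul_rpow (p := 2) (q := 2 * j + 2 * σ) two_pos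
    (by linarith) hs
  have habs := integral_comp_abs
    (f := fun x : ℝ => x ^ (2 * j) * (x ^ (2 * σ) * exp (-s * x ^ 2)))
  simp only [sq_abs, (even_two_mul j).pow_abs] at habs
  rw [weightIntegral_apply]
  simp only [Polynomial.eval_pow, Polynomial.eval_X]
  rw [habs]
  have e : ∫ x in Ioi (0 : ℝ), x ^ (2 * j) * (x ^ (2 * σ) * exp (-s * x ^ 2)) =
      ∫ x in Ioi (0 : ℝ), x ^ (2 * j + 2 * σ) * exp (-s * x ^ (2 : ℝ)) := by
    refine setIntegral_congr_fun measurableSet_Ioi fun x hx => ?_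
    have hx0 : 0 < x := hx
    simp only [rpow_add hx0, rpow_two]
    rw [← rpow_natCast x (2 * j)]
    push_cast
    ring
  rw [e, h, show -(2 * (j : ℝ) + 2 * σ + 1) / 2 = -(j + σ + 1 / 2) by ring,
    show (2 * (j : ℝ) + 2 * σ + 1) / 2 = j + σ + 1 / 2 by ring]
  ring

lemma weightIntegral_recurrence (hσ : -(1/2) < σ) (hs : 0 < s) (j : ℕ) :
    2 * s * weightIntegral hσ hs (Polynomial.X ^ (2 * (j + 1))) =
      (2 * j + 1 + 2 * σ) * weightIntegral hσ hs (Polynomial.X ^ (2 * j)) := by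
  have h0 : (0 : ℝ) ≤ j := j.cast_nonneg
  rw [weightIntegral_X_pow_even, weightIntegral_X_pow_even]
  push_cast
  rw [show (j : ℝ) + 1 + σ + 1 / 2 = (j + σ + 1 / 2) + 1 by ring, Gamma_add_one (by linarith),
    neg_add, rpow_add hs, rpow_neg_one]
  field_simp
  ring

lemma weightIntegral_evenHermite_mul (hσ : -(1/2) < σ) (hs : 0 < s) {n j : ℕ} (hj : j < 2 * n) :
    weightIntegral hσ hs (evenHermite σ s n * Polynomial.X ^ j) = 0 := by
  have key : weightIntegral hσ hs (evenHermite σ s n * Polynomial.X ^ j) =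
      ∑ i ∈ Finset.range (n + 1),
        evenHermiteCoeff σ s n i * weightIntegral hσ hs (Polynomial.X ^ (2 * i + j)) := by
    rw [evenHermite, Finset.sum_mul, map_sum]
    refine Finset.sum_congr rfl fun i _ => ?_
    rw [mul_assoc, ← pow_add, ← Polynomial.smul_eq_C_mul, map_smul, smul_eq_mul]
  rw [key]
  rcases Nat.even_or_odd' j with ⟨m, rfl | rfl⟩
  · rw [← sum_evenHermiteCoeff_mul_eq_zero n hσ hs
      (μ := fun i => weightIntegral hσ hs (Polynomial.X ^ (2 * i)))
      (weightIntegral_recurrence hσ hs) (i := m) (by omega)]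
    refine Finset.sum_congr rfl fun i _ => ?_
    rw [show 2 * (m + i) = 2 * i + 2 * m by ring]
  · refine Finset.sum_eq_zero fun i _ => ?_
    rw [weightIntegral_X_pow_odd hσ hs ⟨i + m, by ring⟩, mul_zero]

lemma exists_eq_C_mul_evenHermite (hσ : -(1/2) < σ) (hs : 0 < s) (p : ℕ → Polynomial ℝ)
    (hdeg : ∀ k, (p k).degree = k)
    (horth : ∀ k l, (∫ x : ℝ,
        (p k).eval x * (p l).eval x * |x| ^ (2 * σ) * Real.exp (-s * x ^ 2)) =
        if k = l then 1 else 0) (n : ℕ) :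
    ∃ a, p (2 * n) = Polynomial.C a * evenHermite σ s n := by
  refine exists_eq_C_mul_of_orthogonal (weightIntegral hσ hs) p hdeg (fun k l => ?_) (2 * n) _
    (degree_evenHermite n hσ hs) fun j hj => weightIntegral_evenHermite_mul hσ hs hj
  rw [← horth, weightIntegral_apply]
  simp only [Polynomial.eval_mul, mul_assoc]

/-- The derivative of `ξ_k` on the positive half-line. -/
noncomputable def xiDeriv (σ s : ℝ) (P : Polynomial ℝ) (x : ℝ) : ℝ :=
  x ^ σ * exp (-s * x ^ 2 / 2) * (P.derivative.eval x + (σ / x - s * x) * P.eval x)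

lemma hasDerivAt_rpow_mul_exp_mul {x : ℝ} (hx : 0 < x) {f : ℝ → ℝ} {f' : ℝ}
    (hf : HasDerivAt f f' x) :
    HasDerivAt (fun x => x ^ σ * exp (-s * x ^ 2 / 2) * f x)
      (x ^ σ * exp (-s * x ^ 2 / 2) * (f' + (σ / x - s * x) * f x)) x := by
  have h1 := hasDerivAt_rpow_const (p := σ) (Or.inl hx.ne')
  have h2 := (((hasDerivAt_pow 2 x).const_mul (-s)).div_const 2).exp
  refine ((h1.fun_mul h2).fun_mul hf).congr_deriv ?_
  rw [rpow_sub_one hx.ne']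
  push_cast
  field_simp
  ring

lemma xiF_even_isHermiteSolution (hσ : -(1/2) < σ) (hσ' : σ < 0) (hs : 0 < s)
    (p : ℕ → Polynomial ℝ) (hdeg : ∀ k, (p k).degree = k)
    (horth : ∀ k l, (∫ x : ℝ,
        (p k).eval x * (p l).eval x * |x| ^ (2 * σ) * Real.exp (-s * x ^ 2)) =
        if k = l then 1 else 0) {n : ℕ} (hn : 1 ≤ n) :
    IsHermiteSolution s √((4 * n + 1 + 2 * σ) / s) (σ * (σ - 1)) (xiF σ s p (2 * n))
      (xiDeriv σ s (p (2 * n))) := by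
  have hn' : (1 : ℝ) ≤ n := by exact_mod_cast hn
  have hN : 4 ≤ 4 * n + 1 + 2 * σ := by linarith
  have hT2 : √((4 * n + 1 + 2 * σ) / s) ^ 2 = (4 * n + 1 + 2 * σ) / s :=
    sq_sqrt (by positivity)
  set P := p (2 * n) with hP
  have hxi : ∀ x, 0 < x → xiF σ s p (2 * n) x = x ^ σ * exp (-s * x ^ 2 / 2) * P.eval x := by
    intro x hx
    rw [xiF, abs_of_pos hx]
    ring
  have hode : ∀ x : ℝ, x * P.derivative.derivative.eval x
      + 2 * (σ - s * x ^ 2) * P.derivative.eval x + 4 * n * s * x * P.eval x = 0 := by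
    intro x
    obtain ⟨a, ha⟩ := exists_eq_C_mul_evenHermite hσ hs p hdeg horth n
    rw [hP, ha]
    simp only [Polynomial.derivative_C_mul, Polynomial.eval_mul, Polynomial.eval_C]
    linear_combination a * evenHermite_ode (s := s) n hσ x
  refine ⟨hs, sqrt_pos.2 (by positivity), by nlinarith, by nlinarith, ?_, ?_, ?_, ?_⟩
  · rw [hT2, mul_div_cancel₀ _ hs.ne']
    exact hN
  · intro x hx
    refine (hasDerivAt_rpow_mul_exp_mul hx (P.hasDerivAt x)).congr_of_eventuallyEq ?_
    filter_upwards [Ioi_mem_nhds hx] with y hy using hxi y hy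
  · intro x hx
    have hφ : HasDerivAt (fun x => σ / x - s * x) (-σ / x ^ 2 - s) x := by
      refine (((hasDerivAt_const x σ).fun_div (hasDerivAt_id' x) hx.ne').fun_sub
        ((hasDerivAt_id' x).const_mul s)).congr_deriv ?_
      ring
    refine (hasDerivAt_rpow_mul_exp_mul hx ((P.derivative.hasDerivAt x).fun_add
      (hφ.fun_mul (P.hasDerivAt x)))).congr_deriv ?_
    rw [hxi x hx, hermitePotential, hT2]
    have h := hode x
    have h' : P.derivative.derivative.eval x = -(2 * (σ - s * x ^ 2) * P.derivative.eval x
        + 4 * n * s * x * P.eval x) / x := by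
      field_simp
      linarith
    rw [h']
    field_simp
    ring
  · intro a b ha hab
    have h1 := horth (2 * n) (2 * n)
    rw [if_pos rfl] at h1
    rw [← h1, intervalIntegral.integral_of_le hab]
    have hI : Integrable fun x : ℝ => P.eval x * P.eval x * |x| ^ (2 * σ) * exp (-s * x ^ 2) := by
      by_contra h
      rw [integral_undef h] at h1
      exact zero_ne_one h1
    have heq : ∫ x in Ioc a b, xiF σ s p (2 * n) x ^ 2 =
        ∫ x in Ioc a b, P.eval x * P.eval x * |x| ^ (2 * σ) * exp (-s * x ^ 2) := by
      refine setIntegral_congr_fun measurableSet_Ioc fun x hx => ?_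
      have hx0 : 0 < x := ha.trans hx.1
      have e1 : x ^ (2 * σ) = x ^ σ * x ^ σ := by rw [two_mul, rpow_add hx0]
      have e2 : exp (-s * x ^ 2) = exp (-s * x ^ 2 / 2) * exp (-s * x ^ 2 / 2) := by
        rw [← exp_add]; congr 1; ring
      simp only [hxi x hx0, abs_of_pos hx0, e1, e2]
      ring
    rw [heq]
    refine setIntegral_le_integral hI (ae_of_all _ fun x => ?_)
    have := mul_self_nonneg (P.eval x)
    simp only [Pi.zero_apply]
    positivity

lemma xiF_even_sq_abs (hσ : -(1/2) < σ) (hs : 0 < s) (p : ℕ → Polynomial ℝ)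
    (hdeg : ∀ k, (p k).degree = k)
    (horth : ∀ k l, (∫ x : ℝ,
        (p k).eval x * (p l).eval x * |x| ^ (2 * σ) * Real.exp (-s * x ^ 2)) =
        if k = l then 1 else 0) (n : ℕ) (x : ℝ) :
    xiF σ s p (2 * n) |x| = xiF σ s p (2 * n) x := by
  obtain ⟨a, ha⟩ := exists_eq_C_mul_evenHermite hσ hs p hdeg horth n
  simp only [xiF, ha, evenHermite, Polynomial.eval_mul, Polynomial.eval_C,
    Polynomial.eval_finsetSum, Polynomial.eval_pow, Polynomial.eval_X, abs_abs, sq_abs,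
    (even_two_mul _).pow_abs]

end

theorem xi_sq_le_of_even_neg (σ s : ℝ) (hσ : -(1/2) < σ) (hσ' : σ < 0) (hs : 0 < s)
    (p : ℕ → Polynomial ℝ)
    (hdeg : ∀ k, (p k).degree = k)
    (hlead : ∀ k, 0 < (p k).leadingCoeff)
    (horth : ∀ k l, (∫ x : ℝ,
        (p k).eval x * (p l).eval x * |x| ^ (2 * σ) * Real.exp (-s * x ^ 2)) =
        if k = l then 1 else 0) :
    ∃ C > (0 : ℝ), ∀ k : ℕ, 2 ≤ k → Even k →
      -- `r` is the smallest positive zero `x_{k,k/2}` of `p_k`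
      ∀ r : ℝ, (0 < r ∧ (p k).IsRoot r ∧ ∀ y : ℝ, 0 < y → (p k).IsRoot y → r ≤ y) →
        ∀ x : ℝ, r ≤ |x| →
          xiF σ s p k x ^ 2 ≤ C * (k : ℝ) ^ (-(1/6) : ℝ) := by
  refine ⟨50000000 * √s, by positivity, ?_⟩
  rintro k hk2 hk r ⟨hr0, hr, -⟩ x hx
  obtain ⟨n, rfl⟩ := hk.two_dvd
  have hn : 1 ≤ n := by omega
  have hn' : (1 : ℝ) ≤ n := by exact_mod_cast hn
  have H := xiF_even_isHermiteSolution hσ hσ' hs p hdeg horth hn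
  have hN : (2 * n : ℝ) ≤ 4 * n + 1 + 2 * σ := by linarith
  set T := √((4 * n + 1 + 2 * σ) / s) with hT
  have hT2 : T ^ 2 = (4 * n + 1 + 2 * σ) / s := sq_sqrt (div_nonneg (by linarith) hs.le)
  set γ := (2000 * T ^ 2 / s ^ 2) ^ (1 / 6 : ℝ) with hγdef
  have hT0 := H.T_pos
  have hγ0 : 0 < γ := rpow_pos_of_pos (by positivity) _
  have hγ6 : γ ^ 6 = 2000 * T ^ 2 / s ^ 2 := by
    rw [hγdef, ← rpow_natCast, ← rpow_mul (by positivity)]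
    norm_num
  have hγ : s ^ 2 * γ ^ 6 = 2000 * T ^ 2 := by
    rw [hγ6]; field_simp
  have hb := H.mul_sq_le hγ0 hγ hr0 (by simp [xiF, Polynomial.IsRoot.def.1 hr]) hx
  rw [xiF_even_sq_abs hσ hs p hdeg horth] at hb
  set K : ℝ := ((2 * n : ℕ) : ℝ) ^ (1 / 6 : ℝ) with hK
  have hn2 : (0 : ℝ) < ((2 * n : ℕ) : ℝ) := by push_cast; linarith
  have hK0 : 0 < K := rpow_pos_of_pos hn2 _
  have hK6 : K ^ 6 = 2 * n := by
    rw [hK, ← rpow_natCast, ← rpow_mul hn2.le]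
    norm_num
  have hKγ : K ≤ √s * γ := by
    refine le_of_pow_le_pow_left₀ (n := 6) (by norm_num) (by positivity) ?_
    have e : (√s * γ) ^ 6 = 2000 * (4 * n + 1 + 2 * σ) := by
      rw [mul_pow, hγ6, hT2, show √s ^ 6 = (√s ^ 2) ^ 3 by ring, sq_sqrt hs.le]
      field_simp
    rw [hK6, e]
    linarith
  rw [rpow_neg hn2.le, ← hK, ← div_eq_mul_inv, le_div_iff₀ hK0]
  calc xiF σ s p (2 * n) x ^ 2 * K ≤ xiF σ s p (2 * n) x ^ 2 * (√s * γ) := by gcongr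
    _ = √s * (γ * xiF σ s p (2 * n) x ^ 2) := by ring
    _ ≤ √s * 50000000 := by gcongr
    _ = 50000000 * √s := by ring
end
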